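/- arXiv:math/0509437 — 10 statements merged into one kernel-verified Lean document; each statement's English description precedes it below -/
import Mathlib

section
/- There exists a countable additive subgroup G of C(X) with the following four properties: (i) G is closed under pointwise max and pointwise min, and q·g ∈ G for all q ∈ ℚ and g ∈ G; (ii) G contains a function f0 such that 0 ≤ f0 ≤ 1, f0(t0) = 0, and f0(t) > 0 for all t ∈ X \ {t0}; (iii) for every f ∈ G there exist an open neighbourhood V of t0 and rationals λ, μ such that f(t) = λ + μ·f0(t) for all t ∈ V; (iv) for every closed set K ⊆ X, every open set V with K ⊆ V, and every rational ρ ≥ 0, there exist an open set U with K ⊆ U ⊆ V and r ∈ G such that 0 ≤ r ≤ ρ on X, r = ρ on U, and r = 0 on X \ V. -/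
open Topology Set Pointwise

/-- A countable subgroup of `C(X, ℝ)` with properties (i)-(iv) from the paper. -/
structure GoodGroup (X : Type*) [TopologicalSpace X] (t0 : X) where
  G : AddSubgroup C(X, ℝ)
  countable : (G : Set C(X, ℝ)).Countable
  sup_mem : ∀ f g : C(X, ℝ), f ∈ G → g ∈ G → f ⊔ g ∈ G
  inf_mem : ∀ f g : C(X, ℝ), f ∈ G → g ∈ G → f ⊓ g ∈ G
  rat_smul_mem : ∀ (q : ℚ) (f : C(X, ℝ)), f ∈ G → (q : ℝ) • f ∈ G
  f0 : C(X, ℝ)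
  f0_mem : f0 ∈ G
  f0_nonneg : ∀ t, 0 ≤ f0 t
  f0_le_one : ∀ t, f0 t ≤ 1
  f0_zero : f0 t0 = 0
  f0_pos : ∀ t, t ≠ t0 → 0 < f0 t
  loc_affine : ∀ f ∈ G, ∃ V : Set X, IsOpen V ∧ t0 ∈ V ∧
      ∃ lam mu : ℚ, ∀ t ∈ V, f t = (lam : ℝ) + (mu : ℝ) * f0 t
  urysohn : ∀ K V : Set X, IsClosed K → IsOpen V → K ⊆ V → ∀ ρ : ℚ, 0 ≤ ρ →
      ∃ U : Set X, IsOpen U ∧ K ⊆ U ∧ U ⊆ V ∧ ∃ r ∈ G,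
        (∀ t, 0 ≤ r t ∧ r t ≤ (ρ : ℝ)) ∧ (∀ t ∈ U, r t = (ρ : ℝ)) ∧
        ∀ t, t ∉ V → r t = 0

variable {X : Type*} [TopologicalSpace X] {t0 : X}

/-- The monoid `M`: `0` together with all nonnegative `f ∈ G` which are strictly
positive on some punctured neighbourhood of `t0`. -/
def Mset (gg : GoodGroup X t0) : Set C(X, ℝ) :=
  {f | f = 0 ∨ (f ∈ gg.G ∧ (∀ t, 0 ≤ f t) ∧
      ∃ V : Set X, IsOpen V ∧ t0 ∈ V ∧ ∀ t ∈ V, t ≠ t0 → 0 < f t)}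

/-- The algebraic order on `M`. -/
def leM (gg : GoodGroup X t0) (g h : C(X, ℝ)) : Prop :=
  ∃ z ∈ Mset gg, h = g + z

/-- The strict algebraic order on `M`. -/
def ltM (gg : GoodGroup X t0) (g h : C(X, ℝ)) : Prop :=
  leM gg g h ∧ g ≠ h

/-- The order-ideal `N_f` generated by `f`. -/
def Nf (gg : GoodGroup X t0) (f : C(X, ℝ)) : Set C(X, ℝ) :=
  {g ∈ Mset gg | ∃ n : ℕ, 1 ≤ n ∧ leM gg g (n • f)}

/-- The canonical interval `D_f`. -/
def Df (gg : GoodGroup X t0) (f : C(X, ℝ)) : Set C(X, ℝ) :=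
  {g ∈ Nf gg f | leM gg g 1}

/-- The co-zero set `U_f` of `f`. -/
def Uf (f : C(X, ℝ)) : Set X := {t | f t ≠ 0}

/-- An order-ideal of `M`: a submonoid hereditary w.r.t. the algebraic order. -/
def IsOrderIdeal (gg : GoodGroup X t0) (O : Set C(X, ℝ)) : Prop :=
  O ⊆ Mset gg ∧ (0 : C(X, ℝ)) ∈ O ∧ (∀ a ∈ O, ∀ b ∈ O, a + b ∈ O) ∧
  ∀ g ∈ Mset gg, ∀ h ∈ O, leM gg g h → g ∈ O

/-- An interval in `N_f`: a nonempty, hereditary, upward directed subset. -/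
def IsInterval (gg : GoodGroup X t0) (f : C(X, ℝ)) (E : Set C(X, ℝ)) : Prop :=
  E.Nonempty ∧ E ⊆ Nf gg f ∧
  (∀ g ∈ Nf gg f, ∀ g' ∈ E, leM gg g g' → g ∈ E) ∧
  ∀ g1 ∈ E, ∀ g2 ∈ E, ∃ g ∈ E, leM gg g1 g ∧ leM gg g2 g

/-- The `n`-fold sum `E + ⋯ + E` of a set of functions. -/
def nFold (n : ℕ) (E : Set C(X, ℝ)) : Set C(X, ℝ) :=
  {x | ∃ y : Fin n → C(X, ℝ), (∀ i, y i ∈ E) ∧ x = ∑ i, y i}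

/-- A complemented interval in `N_f` (with respect to `D_f`). -/
def IsCompInterval (gg : GoodGroup X t0) (f : C(X, ℝ)) (E : Set C(X, ℝ)) : Prop :=
  IsInterval gg f E ∧ ∃ F : Set C(X, ℝ), IsInterval gg f F ∧
    ∃ k : ℕ, 1 ≤ k ∧ E + F = nFold k (Df gg f)

/-- `h` is a nonzero element of `L_f`: a nonnegative bounded continuous function
on `U_f` admitting a nonzero minorant in `N_f`. -/
def MemLfNZ (gg : GoodGroup X t0) (f : C(X, ℝ)) (h : X → ℝ) : Prop :=
  ContinuousOn h (Uf f) ∧ (∃ C : ℝ, ∀ t ∈ Uf f, h t ≤ C) ∧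
  (∀ t ∈ Uf f, 0 ≤ h t) ∧
  ∃ z ∈ Nf gg f, z ≠ (0 : C(X, ℝ)) ∧ ∀ t ∈ Uf f, z t ≤ h t

/-- `h` belongs to `L_f` (either `0` on `U_f`, or has a nonzero minorant in `N_f`). -/
def MemLf (gg : GoodGroup X t0) (f : C(X, ℝ)) (h : X → ℝ) : Prop :=
  ContinuousOn h (Uf f) ∧ (∃ C : ℝ, ∀ t ∈ Uf f, h t ≤ C) ∧
  (∀ t ∈ Uf f, 0 ≤ h t) ∧
  ((∀ t ∈ Uf f, h t = 0) ∨ ∃ z ∈ Nf gg f, z ≠ (0 : C(X, ℝ)) ∧ ∀ t ∈ Uf f, z t ≤ h t)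

/-- The interval `I_f(h)` associated with `h ∈ L_f`. -/
def Iset (gg : GoodGroup X t0) (f : C(X, ℝ)) (h : X → ℝ) : Set C(X, ℝ) :=
  {g | g = 0 ∨ (g ∈ Nf gg f ∧ ∃ z ∈ Nf gg f, ltM gg g z ∧
      (∀ t ∈ Uf f, z t ≤ h t) ∧
      ∃ V : Set X, IsOpen V ∧ t0 ∈ V ∧ ∀ t ∈ (V \ {t0}) ∩ Uf f, z t < h t)}

/-- Property (C) for a nonzero element of `L_f`. -/
def PropC (gg : GoodGroup X t0) (f : C(X, ℝ)) (h : X → ℝ) : Prop :=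
  ∀ t ∈ Uf f, t ≠ t0 → ∃ z ∈ Nf gg f,
    (∀ s ∈ Uf f, z s ≤ h s) ∧
    (∃ W : Set X, IsOpen W ∧ t ∈ W ∧ ∀ s ∈ W ∩ Uf f, z s = h s) ∧
    ∃ V : Set X, IsOpen V ∧ t0 ∈ V ∧ ∀ s ∈ (V \ {t0}) ∩ Uf f, z s < h s

/-- local affineness at `t0` -/
def LocAff0 {X : Type*} [TopologicalSpace X] (t0 : X) (f0 f : C(X, ℝ)) : Prop :=
  ∃ lam mu : ℚ, ∀ᶠ t in 𝓝 t0, f t = (lam : ℝ) + (mu : ℝ) * f0 t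

/-- iterated closure -/
def clIter {X : Type*} [TopologicalSpace X] (S : Set C(X, ℝ)) : ℕ → Set C(X, ℝ)
  | 0 => S
  | n + 1 => clIter S n ∪ (Set.image2 (fun f g => f + g) (clIter S n) (clIter S n)
      ∪ (Set.image2 (fun f g => f ⊔ g) (clIter S n) (clIter S n)
      ∪ Set.image2 (fun (q : ℚ) f => (q : ℝ) • f) Set.univ (clIter S n)))

theorem clIter_countable {X : Type*} [TopologicalSpace X] {S : Set C(X, ℝ)}
    (hS : S.Countable) (n : ℕ) : (clIter S n).Countable := by
  induction n with
  | zero => exact hS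
  | succ n ih =>
    exact ih.union ((ih.image2 ih _).union ((ih.image2 ih _).union
      ((Set.countable_univ).image2 ih _)))

theorem clIter_mono {X : Type*} [TopologicalSpace X] (S : Set C(X, ℝ)) :
    Monotone (clIter S) :=
  monotone_nat_of_le_succ fun _ => Set.subset_union_left

theorem exists_closure {X : Type*} [TopologicalSpace X] (S : Set C(X, ℝ))
    (hS : S.Countable) (P : C(X, ℝ) → Prop) (hP : ∀ f ∈ S, P f)
    (hadd : ∀ f g, P f → P g → P (f + g)) (hsup : ∀ f g, P f → P g → P (f ⊔ g))
    (hsm : ∀ (q : ℚ) f, P f → P ((q : ℝ) • f)) :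
    ∃ G : Set C(X, ℝ), G.Countable ∧ S ⊆ G ∧ (∀ f ∈ G, P f) ∧
      (∀ f ∈ G, ∀ g ∈ G, f + g ∈ G) ∧ (∀ f ∈ G, ∀ g ∈ G, f ⊔ g ∈ G) ∧
      (∀ (q : ℚ), ∀ f ∈ G, (q : ℝ) • f ∈ G) := by
  refine ⟨⋃ n, clIter S n, Set.countable_iUnion (clIter_countable hS),
    Set.subset_iUnion (clIter S) 0, ?_, ?_, ?_, ?_⟩
  · intro f hf
    obtain ⟨n, hn⟩ := Set.mem_iUnion.1 hf
    clear hf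
    induction n generalizing f with
    | zero => exact hP f hn
    | succ n ih =>
      rcases hn with h | ⟨a, ha, b, hb, rfl⟩ | ⟨a, ha, b, hb, rfl⟩ | ⟨q, -, b, hb, rfl⟩
      · exact ih f h
      · exact hadd _ _ (ih _ ha) (ih _ hb)
      · exact hsup _ _ (ih _ ha) (ih _ hb)
      · exact hsm _ _ (ih _ hb)
  · intro f hf g hg
    obtain ⟨n, hn⟩ := Set.mem_iUnion.1 hf
    obtain ⟨m, hm⟩ := Set.mem_iUnion.1 hg
    refine Set.mem_iUnion.2 ⟨max n m + 1, Or.inr (Or.inl ⟨f, ?_, g, ?_, rfl⟩)⟩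
    · exact clIter_mono S (le_max_left _ _) hn
    · exact clIter_mono S (le_max_right _ _) hm
  · intro f hf g hg
    obtain ⟨n, hn⟩ := Set.mem_iUnion.1 hf
    obtain ⟨m, hm⟩ := Set.mem_iUnion.1 hg
    refine Set.mem_iUnion.2 ⟨max n m + 1, Or.inr (Or.inr (Or.inl ⟨f, ?_, g, ?_, rfl⟩))⟩
    · exact clIter_mono S (le_max_left _ _) hn
    · exact clIter_mono S (le_max_right _ _) hm
  · intro q f hf
    obtain ⟨n, hn⟩ := Set.mem_iUnion.1 hf
    exact Set.mem_iUnion.2 ⟨n + 1, Or.inr (Or.inr (Or.inr ⟨q, trivial, f, hn, rfl⟩))⟩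

theorem locAff0_add {X : Type*} [TopologicalSpace X] {t0 : X} {f0 : C(X, ℝ)}
    (f g : C(X, ℝ)) (hf : LocAff0 t0 f0 f) (hg : LocAff0 t0 f0 g) :
    LocAff0 t0 f0 (f + g) := by
  obtain ⟨a, b, h⟩ := hf
  obtain ⟨c, d, h'⟩ := hg
  refine ⟨a + c, b + d, ?_⟩
  filter_upwards [h, h'] with t h1 h2
  rw [ContinuousMap.add_apply, h1, h2]
  push_cast
  ring

theorem locAff0_smul {X : Type*} [TopologicalSpace X] {t0 : X} {f0 : C(X, ℝ)}
    (q : ℚ) (f : C(X, ℝ)) (hf : LocAff0 t0 f0 f) :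
    LocAff0 t0 f0 ((q : ℝ) • f) := by
  obtain ⟨a, b, h⟩ := hf
  refine ⟨q * a, q * b, ?_⟩
  filter_upwards [h] with t h1
  rw [ContinuousMap.smul_apply, h1, smul_eq_mul]
  push_cast
  ring

theorem locAff0_sup {X : Type*} [TopologicalSpace X] {t0 : X} {f0 : C(X, ℝ)}
    (h0 : ∀ t, 0 ≤ f0 t) (hz : f0 t0 = 0)
    (f g : C(X, ℝ)) (hf : LocAff0 t0 f0 f) (hg : LocAff0 t0 f0 g) :
    LocAff0 t0 f0 (f ⊔ g) := by
  have key : ∀ f g : C(X, ℝ), ∀ a b c d : ℚ,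
      (∀ᶠ t in 𝓝 t0, f t = (a : ℝ) + (b : ℝ) * f0 t) →
      (∀ᶠ t in 𝓝 t0, g t = (c : ℝ) + (d : ℝ) * f0 t) →
      (a < c ∨ (a = c ∧ b ≤ d)) → LocAff0 t0 f0 (f ⊔ g) := by
    intro f g a b c d h h' hc
    refine ⟨c, d, ?_⟩
    have hle : ∀ᶠ t in 𝓝 t0, f t ≤ g t := by
      rcases hc with hc | ⟨rfl, hc⟩
      · have e1 := h.self_of_nhds
        have e2 := h'.self_of_nhds
        have hlt : f t0 < g t0 := by
          rw [e1, e2, hz]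
          simpa using hc
        filter_upwards [(f.continuous.tendsto t0).eventually_lt (g.continuous.tendsto t0) hlt]
          with t ht using ht.le
      · filter_upwards [h, h'] with t h1 h2
        rw [h1, h2]
        have : (b : ℝ) ≤ d := by exact_mod_cast hc
        have := mul_le_mul_of_nonneg_right this (h0 t)
        linarith
    filter_upwards [hle, h'] with t h1 h2
    rw [ContinuousMap.sup_apply, sup_eq_right.2 h1, h2]
  obtain ⟨a, b, h⟩ := hf
  obtain ⟨c, d, h'⟩ := hg
  rcases lt_trichotomy a c with hac | hac | hac
  · exact key f g a b c d h h' (Or.inl hac)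
  · rcases le_total b d with hbd | hbd
    · exact key f g a b c d h h' (Or.inr ⟨hac, hbd⟩)
    · rw [sup_comm]
      exact key g f c d a b h' h (Or.inr ⟨hac.symm, hbd⟩)
  · rw [sup_comm]
    exact key g f c d a b h' h (Or.inl hac)

theorem exists_good_base (X : Type*) [TopologicalSpace X] [CompactSpace X]
    [TopologicalSpace.MetrizableSpace X] :
    ∃ A : Set (Set X), A.Countable ∧ (∀ U ∈ A, IsOpen U) ∧
      ∀ K V : Set X, IsClosed K → IsOpen V → K ⊆ V → ∃ U ∈ A, K ⊆ U ∧ closure U ⊆ V := by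
  letI := TopologicalSpace.metrizableSpaceMetric X
  haveI : SecondCountableTopology X := inferInstance
  let B := TopologicalSpace.countableBasis X
  have hB : TopologicalSpace.IsTopologicalBasis B := TopologicalSpace.isBasis_countableBasis X
  refine ⟨Set.sUnion '' {s | s.Finite ∧ s ⊆ B}, ?_, ?_, ?_⟩
  · exact (Set.countable_setOf_finite_subset
      (TopologicalSpace.countable_countableBasis X)).image _
  · rintro _ ⟨s, ⟨-, hs⟩, rfl⟩
    exact isOpen_sUnion fun u hu => hB.isOpen (hs hu)
  · intro K V hK hV hKV
    obtain ⟨u, hu, hKu, huV⟩ := normal_exists_closure_subset hK hV hKV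
    obtain ⟨s, hs, rfl⟩ := hB.open_eq_sUnion hu
    obtain ⟨t, hts, htf, hKt⟩ := hK.isCompact.elim_finite_subcover_image (b := s) (c := id)
      (fun i hi => hB.isOpen (hs hi)) (by simpa [Set.sUnion_eq_biUnion] using hKu)
    refine ⟨⋃₀ t, ⟨t, ⟨htf, hts.trans hs⟩, rfl⟩, ?_, ?_⟩
    · simpa [Set.sUnion_eq_biUnion] using hKt
    · exact (closure_mono (Set.sUnion_subset_sUnion hts)).trans huV

variable [CompactSpace X] [TopologicalSpace.MetrizableSpace X] [Infinite X]

/-- existence of a countable subgroup `G` of `C(X)` with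
properties (i)-(iv). -/
theorem statement_0 (ht0 : Filter.NeBot (𝓝[≠] t0)) :
    Nonempty (GoodGroup X t0) := by
  obtain ⟨f0, h0, h1, hz, hpos⟩ : ∃ f0 : C(X, ℝ), (∀ t, 0 ≤ f0 t) ∧ (∀ t, f0 t ≤ 1) ∧
      f0 t0 = 0 ∧ ∀ t, t ≠ t0 → 0 < f0 t := by
    letI := TopologicalSpace.metrizableSpaceMetric X
    refine ⟨⟨fun t => min (dist t t0) 1, by fun_prop⟩, fun t => ?_, fun t => ?_, ?_,
      fun t ht => ?_⟩
    · exact le_min dist_nonneg zero_le_one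
    · exact min_le_right _ _
    · simp
    · exact lt_min (dist_pos.2 ht) one_pos
  obtain ⟨A, hAc, hAo, hA⟩ := exists_good_base X
  have hF : ∀ p : Set X × Set X, ∃ r : C(X, ℝ), (∀ t, 0 ≤ r t ∧ r t ≤ 1) ∧
      LocAff0 t0 f0 r ∧ (IsOpen p.1 → IsOpen p.2 → closure p.1 ⊆ p.2 →
        (t0 ∈ p.1 ∨ t0 ∉ closure p.2) → (∀ t ∈ p.1, r t = 1) ∧ ∀ t, t ∉ p.2 → r t = 0) := by
    rintro ⟨a, b⟩
    by_cases h : IsOpen a ∧ IsOpen b ∧ closure a ⊆ b ∧ (t0 ∈ a ∨ t0 ∉ closure b)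
    · obtain ⟨ha, hb, hab, ht⟩ := h
      obtain ⟨r, r0, r1, r01⟩ := exists_continuous_zero_one_of_isClosed hb.isClosed_compl
        isClosed_closure (disjoint_compl_left_iff_subset.2 hab)
      refine ⟨r, fun t => r01 t, ?_, fun _ _ _ _ => ⟨fun t ht => r1 (subset_closure ht),
        fun t ht => r0 ht⟩⟩
      rcases ht with ht | ht
      · refine ⟨1, 0, ?_⟩
        filter_upwards [ha.mem_nhds ht] with t ht
        have := r1 (subset_closure ht)
        simpa using this
      · refine ⟨0, 0, ?_⟩
        filter_upwards [isClosed_closure.isOpen_compl.mem_nhds ht] with t ht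
        have := r0 (show t ∈ bᶜ from fun h => ht (subset_closure h))
        simpa using this
    · refine ⟨0, fun t => by simp, ⟨0, 0, by simp⟩, fun h1 h2 h3 h4 => absurd ⟨h1, h2, h3, h4⟩ h⟩
  choose F hF01 hFl hFp using hF
  obtain ⟨G, hGc, hSG, hGP, hadd, hsup, hsm⟩ := exists_closure (insert f0 (F '' (A ×ˢ A)))
    (((hAc.prod hAc).image F).insert f0) (LocAff0 t0 f0)
    (by
      rintro f (rfl | ⟨p, -, rfl⟩)
      · exact ⟨0, 1, by simp⟩
      · exact hFl p)
    locAff0_add (locAff0_sup h0 hz) locAff0_smul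
  have hf0 : f0 ∈ G := hSG (Set.mem_insert _ _)
  have hneg : ∀ f ∈ G, -f ∈ G := fun f hf => by simpa using hsm (-1) f hf
  refine ⟨{ G := { carrier := G, add_mem' := fun {a b} ha hb => hadd a ha b hb,
                   zero_mem' := by simpa using hsm 0 f0 hf0,
                   neg_mem' := fun {a} ha => hneg a ha }
            countable := hGc
            sup_mem := fun f g hf hg => hsup f hf g hg
            inf_mem := ?_
            rat_smul_mem := fun q f hf => hsm q f hf
            f0 := f0
            f0_mem := hf0
            f0_nonneg := h0
            f0_le_one := h1
            f0_zero := hz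
            f0_pos := hpos
            loc_affine := ?_
            urysohn := ?_ }⟩
  · intro f g hf hg
    have h := hneg _ (hsup _ (hneg f hf) _ (hneg g hg))
    have e : -(-f ⊔ -g) = f ⊓ g := by
      ext t
      simp [max_neg_neg]
    rw [e] at h
    exact h
  · intro f hf
    obtain ⟨a, b, h⟩ := hGP f hf
    obtain ⟨V, hV, hVo, hVt⟩ := eventually_nhds_iff.1 h
    exact ⟨V, hVo, hVt, a, b, hV⟩
  · intro K V hK hV hKV ρ hρ
    have hρ' : (0 : ℝ) ≤ ρ := by exact_mod_cast hρ
    obtain ⟨a, haA, b, hbA, hKa, hab, hbV, ht⟩ : ∃ a ∈ A, ∃ b ∈ A, K ⊆ a ∧ closure a ⊆ b ∧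
        closure b ⊆ V ∧ (t0 ∈ a ∨ t0 ∉ closure b) := by
      by_cases ht : t0 ∈ V
      · obtain ⟨b, hb, hKb, hbV⟩ := hA (insert t0 K) V (isClosed_singleton.union hK) hV
          (Set.insert_subset ht hKV)
        obtain ⟨a, ha, hKa, hab⟩ := hA (insert t0 K) b (isClosed_singleton.union hK) (hAo b hb) hKb
        exact ⟨a, ha, b, hb, (Set.subset_insert _ _).trans hKa, hab, hbV,
          Or.inl (hKa (Set.mem_insert _ _))⟩
      · obtain ⟨b, hb, hKb, hbV⟩ := hA K V hK hV hKV
        obtain ⟨a, ha, hKa, hab⟩ := hA K b hK (hAo b hb) hKb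
        exact ⟨a, ha, b, hb, hKa, hab, hbV, Or.inr fun h => ht (hbV h)⟩
    obtain ⟨hr1, hr0⟩ := hFp (a, b) (hAo a haA) (hAo b hbA) hab ht
    refine ⟨a, hAo a haA, hKa, subset_closure.trans (hab.trans (subset_closure.trans hbV)),
      (ρ : ℝ) • F (a, b), hsm ρ _ (hSG (Or.inr ⟨(a, b), ⟨haA, hbA⟩, rfl⟩)), ?_, ?_, ?_⟩
    · intro t
      obtain ⟨h2, h3⟩ := hF01 (a, b) t
      simp only [ContinuousMap.smul_apply, smul_eq_mul]
      exact ⟨mul_nonneg hρ' h2, mul_le_of_le_one_right hρ' h3⟩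
    · intro t ht
      simp [hr1 t ht]
    · intro t ht
      simp [hr0 t (fun h => ht (hbV (subset_closure h)))]
end

section
/- The monoid M, equipped with the algebraic order ≤_M, is a prime cancellative Riesz monoid; that is: (a) a + c = b + c implies a = b for all a, b, c ∈ M; (b) whenever x, y1, y2 ∈ M satisfy x ≤_M y1 + y2, there exist x1, x2 ∈ M with x = x1 + x2, x1 ≤_M y1 and x2 ≤_M y2; (c) any two order-ideals of M both different from {0} have intersection different from {0}, where an order-ideal of M is a submonoid O such that g ∈ M, g ≤_M h and h ∈ O imply g ∈ O. -/
open Topology Set Pointwise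

variable {X : Type*} [TopologicalSpace X] {t0 : X}

theorem Mset_mk_aux {X : Type*} [TopologicalSpace X] {t0 : X} (gg : GoodGroup X t0)
    (f : C(X, ℝ)) (hf : f ∈ gg.G)
    (h0 : ∀ t, 0 ≤ f t) (h : ∀ᶠ t in 𝓝[≠] t0, 0 < f t) : f ∈ Mset gg := by
  right
  refine ⟨hf, h0, ?_⟩
  rw [eventually_nhdsWithin_iff, eventually_nhds_iff] at h
  obtain ⟨V, h1, h2, h3⟩ := h
  exact ⟨V, h2, h3, fun t ht hne => h1 t ht hne⟩

theorem Mset_dest_aux {X : Type*} [TopologicalSpace X] {t0 : X} (gg : GoodGroup X t0)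
    (f : C(X, ℝ)) (hf : f ∈ Mset gg) (hne : f ≠ 0) :
    f ∈ gg.G ∧ (∀ t, 0 ≤ f t) ∧ ∀ᶠ t in 𝓝[≠] t0, 0 < f t := by
  rcases hf with h | ⟨h1, h2, V, h3, h4, h5⟩
  · exact absurd h hne
  · refine ⟨h1, h2, ?_⟩
    rw [eventually_nhdsWithin_iff, eventually_nhds_iff]
    exact ⟨V, fun t ht hn => h5 t ht hn, h3, h4⟩

theorem half_mem_aux {X : Type*} [TopologicalSpace X] {t0 : X} (gg : GoodGroup X t0)
    (f : C(X, ℝ)) (hf : f ∈ gg.G) : (1 / 2 : ℝ) • f ∈ gg.G := by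
  have := gg.rat_smul_mem (1 / 2) f hf
  push_cast at this
  exact this

variable [CompactSpace X] [TopologicalSpace.MetrizableSpace X] [Infinite X]

/-- `(M, ≤_M)` is a prime cancellative Riesz monoid. -/
theorem statement_1 (ht0 : Filter.NeBot (𝓝[≠] t0)) (gg : GoodGroup X t0) :
    (∀ a ∈ Mset gg, ∀ b ∈ Mset gg, ∀ c ∈ Mset gg, a + c = b + c → a = b) ∧
    (∀ x ∈ Mset gg, ∀ y1 ∈ Mset gg, ∀ y2 ∈ Mset gg, leM gg x (y1 + y2) →
      ∃ x1 ∈ Mset gg, ∃ x2 ∈ Mset gg,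
        x = x1 + x2 ∧ leM gg x1 y1 ∧ leM gg x2 y2) ∧
    (∀ O1 O2 : Set C(X, ℝ), IsOrderIdeal gg O1 → IsOrderIdeal gg O2 →
      O1 ≠ {0} → O2 ≠ {0} → O1 ∩ O2 ≠ {0}) := by
  refine ⟨fun a _ b _ c _ h => add_right_cancel h, ?_, ?_⟩
  · rintro x hx y1 hy1 y2 hy2 ⟨z, hz, he⟩
    have hz0 : (0 : C(X, ℝ)) ∈ Mset gg := Or.inl rfl
    by_cases x0 : x = 0
    · exact ⟨0, hz0, 0, hz0, by simp [x0], ⟨y1, hy1, by simp⟩, ⟨y2, hy2, by simp⟩⟩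
    by_cases z0 : z = 0
    · exact ⟨y1, hy1, y2, hy2, by simp [he, z0], ⟨0, hz0, by simp⟩, ⟨0, hz0, by simp⟩⟩
    by_cases y10 : y1 = 0
    · refine ⟨0, hz0, x, hx, by simp, ⟨0, hz0, by simp [y10]⟩, ⟨z, hz, ?_⟩⟩
      simpa [y10] using he
    by_cases y20 : y2 = 0
    · refine ⟨x, hx, 0, hz0, by simp, ⟨z, hz, ?_⟩, ⟨0, hz0, by simp [y20]⟩⟩
      simpa [y20] using he
    obtain ⟨xG, xn, xp⟩ := Mset_dest_aux gg x hx x0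
    obtain ⟨zG, zn, zp⟩ := Mset_dest_aux gg z hz z0
    obtain ⟨yG, yn, yp⟩ := Mset_dest_aux gg y1 hy1 y10
    obtain ⟨wG, wn, wp⟩ := Mset_dest_aux gg y2 hy2 y20
    have hpt : ∀ t, y1 t + y2 t = x t + z t := fun t => by
      simpa using DFunLike.congr_fun he t
    set a : C(X, ℝ) := 0 ⊔ (x - y2) with ha
    set b : C(X, ℝ) := x ⊓ y1 with hb
    have aG : a ∈ gg.G := gg.sup_mem _ _ gg.G.zero_mem (gg.G.sub_mem xG wG)
    have bG : b ∈ gg.G := gg.inf_mem _ _ xG yG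
    have cG := half_mem_aux gg _ (gg.G.add_mem aG bG)
    set c : C(X, ℝ) := (1 / 2 : ℝ) • (a + b) with hc
    have ct : ∀ t, c t = (1 / 2 : ℝ) * (max 0 (x t - y2 t) + min (x t) (y1 t)) := by
      intro t; simp [hc, ha, hb]; ring
    have nn : ∀ t, 0 ≤ c t ∧ c t ≤ x t ∧ c t ≤ y1 t ∧ x t - c t ≤ y2 t := by
      intro t
      have := xn t; have := zn t; have := yn t; have := wn t; have := hpt t
      rw [ct]
      rcases max_cases 0 (x t - y2 t) with h | h <;> rcases min_cases (x t) (y1 t) with h' | h' <;>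
        rw [h.1, h'.1] <;> refine ⟨?_, ?_, ?_, ?_⟩ <;> linarith
    have pp : ∀ᶠ t in 𝓝[≠] t0, 0 < c t ∧ c t < x t ∧ c t < y1 t ∧ x t - c t < y2 t := by
      filter_upwards [xp, zp, yp, wp] with t h1 h2 h3 h4
      have := hpt t
      rw [ct]
      rcases max_cases 0 (x t - y2 t) with h | h <;> rcases min_cases (x t) (y1 t) with h' | h' <;>
        rw [h.1, h'.1] <;> refine ⟨?_, ?_, ?_, ?_⟩ <;> linarith
    refine ⟨c, Mset_mk_aux gg c cG (fun t => (nn t).1) (pp.mono fun t h => h.1),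
      x - c, Mset_mk_aux gg _ (gg.G.sub_mem xG cG) ?_ ?_, by abel,
      ⟨y1 - c, Mset_mk_aux gg _ (gg.G.sub_mem yG cG) ?_ ?_, by abel⟩,
      ⟨y2 - (x - c), Mset_mk_aux gg _ (gg.G.sub_mem wG (gg.G.sub_mem xG cG)) ?_ ?_, by abel⟩⟩
    · intro t; have := (nn t).2.1; simpa using this
    · filter_upwards [pp] with t h; simpa using h.2.1
    · intro t; have := (nn t).2.2.1; simpa using this
    · filter_upwards [pp] with t h; simpa using h.2.2.1
    · intro t; have := (nn t).2.2.2
      simp only [ContinuousMap.sub_apply]; linarith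
    · filter_upwards [pp] with t h
      have := h.2.2.2
      simp only [ContinuousMap.sub_apply]; linarith
  · intro O1 O2 hO1 hO2 h1 h2 heq
    have ex : ∀ O : Set C(X, ℝ), IsOrderIdeal gg O → O ≠ {0} → ∃ h ∈ O, h ≠ 0 := by
      intro O hO hne
      by_contra! hcon
      exact hne (Set.eq_singleton_iff_unique_mem.2 ⟨hO.2.1, hcon⟩)
    obtain ⟨p, pO, p0⟩ := ex O1 hO1 h1
    obtain ⟨q, qO, q0⟩ := ex O2 hO2 h2
    obtain ⟨pG, pn, pp⟩ := Mset_dest_aux gg p (hO1.1 pO) p0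
    obtain ⟨qG, qn, qp⟩ := Mset_dest_aux gg q (hO2.1 qO) q0
    have cG := half_mem_aux gg _ (gg.inf_mem _ _ pG qG)
    set c : C(X, ℝ) := (1 / 2 : ℝ) • (p ⊓ q) with hc
    have ct : ∀ t, c t = (1 / 2 : ℝ) * min (p t) (q t) := by
      intro t; simp [hc]
    have nn : ∀ t, 0 ≤ c t ∧ c t ≤ p t ∧ c t ≤ q t := by
      intro t
      have := pn t; have := qn t
      rw [ct]
      rcases min_cases (p t) (q t) with h' | h' <;>
        rw [h'.1] <;> refine ⟨?_, ?_, ?_⟩ <;> linarith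
    have pos : ∀ᶠ t in 𝓝[≠] t0, 0 < c t ∧ c t < p t ∧ c t < q t := by
      filter_upwards [pp, qp] with t h1 h2
      rw [ct]
      rcases min_cases (p t) (q t) with h' | h' <;>
        rw [h'.1] <;> refine ⟨?_, ?_, ?_⟩ <;> linarith
    have cM : c ∈ Mset gg :=
      Mset_mk_aux gg c cG (fun t => (nn t).1) (pos.mono fun t h => h.1)
    have m1 : c ∈ O1 := by
      refine hO1.2.2.2 c cM p pO ⟨p - c, Mset_mk_aux gg _ (gg.G.sub_mem pG cG) ?_ ?_, by abel⟩
      · intro t; have := (nn t).2.1; simpa using this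
      · filter_upwards [pos] with t h; simpa using h.2.1
    have m2 : c ∈ O2 := by
      refine hO2.2.2.2 c cM q qO ⟨q - c, Mset_mk_aux gg _ (gg.G.sub_mem qG cG) ?_ ?_, by abel⟩
      · intro t; have := (nn t).2.2; simpa using this
      · filter_upwards [pos] with t h; simpa using h.2.2
    have hc0 : c = 0 := by
      have : c ∈ O1 ∩ O2 := ⟨m1, m2⟩
      rw [heq] at this
      exact this
    obtain ⟨t, ht⟩ := pos.exists
    rw [hc0] at ht
    simpa using ht.1
end

section
/- Let f ∈ M be nonzero with f ≤_M f0, and let E be an interval in N_f with E ≠ {0}. Then there exist a nonzero f' ∈ M with f' ≤_M f, an integer n ≥ 1, and an interval F in N_{f'} such that ({g ∈ M : g ≤_M f0} ∩ N_{f'}) + F = n·(E ∩ N_{f'}). -/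
open Topology Set Pointwise

variable {X : Type*} [TopologicalSpace X] {t0 : X}

/-- Nonzero elements of `M`. -/
def PosM (gg : GoodGroup X t0) (z : C(X, ℝ)) : Prop :=
  z ∈ gg.G ∧ (∀ t, 0 ≤ z t) ∧ ∀ᶠ t in 𝓝[≠] t0, 0 < z t

lemma mem_Mset_iff (gg : GoodGroup X t0) (z : C(X, ℝ)) : z ∈ Mset gg ↔ z = 0 ∨ PosM gg z := by
  unfold Mset PosM
  simp only [mem_ofPred_eq]
  have : (∃ V : Set X, IsOpen V ∧ t0 ∈ V ∧ ∀ t ∈ V, t ≠ t0 → 0 < z t) ↔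
      ∀ᶠ t in 𝓝[≠] t0, 0 < z t := by
    rw [eventually_nhdsWithin_iff, eventually_nhds_iff]
    constructor
    · rintro ⟨V, h1, h2, h3⟩
      exact ⟨V, fun t ht h => h3 t ht h, h1, h2⟩
    · rintro ⟨V, h3, h1, h2⟩
      exact ⟨V, h1, h2, fun t ht h => h3 t ht h⟩
  rw [this]

lemma Mset_G {gg : GoodGroup X t0} {z : C(X, ℝ)} (h : z ∈ Mset gg) : z ∈ gg.G := by
  rcases (mem_Mset_iff gg z).1 h with rfl | h
  · exact gg.G.zero_mem
  · exact h.1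

lemma Mset_nonneg {gg : GoodGroup X t0} {z : C(X, ℝ)} (h : z ∈ Mset gg) (t : X) : 0 ≤ z t := by
  rcases (mem_Mset_iff gg z).1 h with rfl | h
  · simp
  · exact h.2.1 t

lemma PosM.mem {gg : GoodGroup X t0} {z : C(X, ℝ)} (h : PosM gg z) : z ∈ Mset gg :=
  (mem_Mset_iff gg z).2 (Or.inr h)

lemma zero_mem_Mset (gg : GoodGroup X t0) : (0 : C(X, ℝ)) ∈ Mset gg := Or.inl rfl

lemma PosM.mono {gg : GoodGroup X t0} {z w : C(X, ℝ)} (h : PosM gg z) (hw : w ∈ gg.G)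
    (hzw : ∀ t, z t ≤ w t) : PosM gg w :=
  ⟨hw, fun t => (h.2.1 t).trans (hzw t), h.2.2.mono fun t ht => ht.trans_le (hzw t)⟩

lemma PosM.inf {gg : GoodGroup X t0} {z w : C(X, ℝ)} (h : PosM gg z) (h' : PosM gg w) :
    PosM gg (z ⊓ w) := by
  refine ⟨gg.inf_mem _ _ h.1 h'.1, fun t => ?_, ?_⟩
  · simpa using ⟨h.2.1 t, h'.2.1 t⟩
  · filter_upwards [h.2.2, h'.2.2] with t h1 h2
    simpa using ⟨h1, h2⟩

lemma PosM.smul {gg : GoodGroup X t0} {z : C(X, ℝ)} (h : PosM gg z) {q : ℚ} (hq : 0 < q) :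
    PosM gg ((q : ℝ) • z) := by
  have hq' : (0 : ℝ) < q := by exact_mod_cast hq
  refine ⟨gg.rat_smul_mem _ _ h.1, fun t => ?_, ?_⟩
  · simpa using mul_nonneg hq'.le (h.2.1 t)
  · filter_upwards [h.2.2] with t h1
    simpa using mul_pos hq' h1

lemma PosM.half {gg : GoodGroup X t0} {z : C(X, ℝ)} (h : PosM gg z) :
    ∃ w, PosM gg w ∧ ∀ t, w t = z t / 2 := by
  refine ⟨_, h.smul (q := 1/2) (by norm_num), fun t => ?_⟩
  simp; ring

lemma Mset.smul {gg : GoodGroup X t0} {z : C(X, ℝ)} (h : z ∈ Mset gg) {q : ℚ} (hq : 0 < q) :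
    (q : ℝ) • z ∈ Mset gg := by
  rcases (mem_Mset_iff gg z).1 h with rfl | h
  · simpa using zero_mem_Mset gg
  · exact (h.smul hq).mem

lemma Mset.add {gg : GoodGroup X t0} {z w : C(X, ℝ)} (h : z ∈ Mset gg) (h' : w ∈ Mset gg) :
    z + w ∈ Mset gg := by
  rcases (mem_Mset_iff gg z).1 h with rfl | h
  · simpa using h'
  · refine (h.mono (gg.G.add_mem h.1 (Mset_G h')) fun t => ?_).mem
    have := Mset_nonneg h' t
    simp [this]

lemma PosM.ne [hn : Filter.NeBot (𝓝[≠] t0)] {gg : GoodGroup X t0} {z : C(X, ℝ)}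
    (h : PosM gg z) : z ≠ 0 := by
  rintro rfl
  obtain ⟨t, ht⟩ := h.2.2.exists
  simp at ht

lemma Mset.pos {gg : GoodGroup X t0} {z : C(X, ℝ)} (h : z ∈ Mset gg) (hz : z ≠ 0) :
    PosM gg z := ((mem_Mset_iff gg z).1 h).resolve_left hz

lemma leM_iff (gg : GoodGroup X t0) (x y : C(X, ℝ)) :
    leM gg x y ↔ x = y ∨ PosM gg (y - x) := by
  unfold leM
  constructor
  · rintro ⟨z, hz, rfl⟩
    rcases (mem_Mset_iff gg z).1 hz with rfl | h
    · left; simp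
    · right; simpa using h
  · rintro (rfl | h)
    · exact ⟨0, zero_mem_Mset gg, by simp⟩
    · exact ⟨_, h.mem, by simp⟩

lemma leM_le {gg : GoodGroup X t0} {x y : C(X, ℝ)} (h : leM gg x y) (t : X) : x t ≤ y t := by
  obtain ⟨z, hz, rfl⟩ := h
  simpa using Mset_nonneg hz t

lemma mem_Nf_iff {gg : GoodGroup X t0} {f : C(X, ℝ)} (hf : PosM gg f) (x : C(X, ℝ)) :
    x ∈ Nf gg f ↔ x ∈ Mset gg ∧ ∃ k : ℕ, ∀ t, x t ≤ k * f t := by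
  constructor
  · rintro ⟨h, n, hn, h'⟩
    refine ⟨h, n, fun t => ?_⟩
    simpa using leM_le h' t
  · rintro ⟨h, k, hk⟩
    refine ⟨h, k + 1, by omega, (leM_iff _ _ _).2 (Or.inr ?_)⟩
    refine hf.mono (gg.G.sub_mem (gg.G.nsmul_mem hf.1 _) (Mset_G h)) fun t => ?_
    have := hk t
    simp
    linarith

/-- Near `t0`, an element of `M` vanishing at `t0` is a multiple of `f0`. -/
lemma PosM.slope [hn : Filter.NeBot (𝓝[≠] t0)] {gg : GoodGroup X t0} {z : C(X, ℝ)}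
    (h : PosM gg z) (h0 : z t0 = 0) : ∃ V : Set X, IsOpen V ∧ t0 ∈ V ∧
      ∃ mu : ℚ, 0 < mu ∧ ∀ t ∈ V, z t = (mu : ℝ) * gg.f0 t := by
  obtain ⟨V, hV, htV, lam, mu, hz⟩ := gg.loc_affine z h.1
  have hl : (lam : ℝ) = 0 := by
    have := hz t0 htV
    rw [h0, gg.f0_zero] at this
    linarith
  have hz' : ∀ t ∈ V, z t = (mu : ℝ) * gg.f0 t := fun t ht => by rw [hz t ht, hl, zero_add]
  refine ⟨V, hV, htV, mu, ?_, hz'⟩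
  obtain ⟨t, ht, htV'⟩ := (h.2.2.and (mem_nhdsWithin_of_mem_nhds (hV.mem_nhds htV))).exists
  rw [hz' t htV'] at ht
  have : (0 : ℝ) < mu := pos_of_mul_pos_left ht (gg.f0_nonneg t)
  exact_mod_cast this

lemma exists_bump [T1Space X] (gg : GoodGroup X t0) (V : Set X) (hV : IsOpen V) (h0 : t0 ∈ V) :
    ∃ b, PosM gg b ∧ ∀ t, t ∉ V → b t = 0 := by
  obtain ⟨U, hU, hKU, -, r, hr, h1, h2, h3⟩ :=
    gg.urysohn {t0} V isClosed_singleton hV (by simpa using h0) 1 (by norm_num)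
  refine ⟨r, ⟨hr, fun t => (h1 t).1, ?_⟩, h3⟩
  have : U ∈ 𝓝[≠] t0 := mem_nhdsWithin_of_mem_nhds (hU.mem_nhds (hKU rfl))
  filter_upwards [this] with t ht
  rw [h2 t ht]; norm_num

/-- An interval without maximum, in a pointwise form. -/
structure Soft (gg : GoodGroup X t0) (S : Set C(X, ℝ)) : Prop where
  sub : S ⊆ Mset gg
  zero : 0 ∈ S
  her : ∀ x ∈ Mset gg, ∀ y ∈ S, PosM gg (y - x) → x ∈ S
  dir : ∀ x ∈ S, ∀ y ∈ S, ∃ z ∈ S, PosM gg (z - x) ∧ PosM gg (z - y)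

lemma PosM.le {gg : GoodGroup X t0} {x y : C(X, ℝ)} (h : PosM gg (y - x)) (t : X) :
    x t ≤ y t := by
  have := h.2.1 t
  simpa using this

lemma Soft.her_le {gg : GoodGroup X t0} {S : Set C(X, ℝ)} (hS : Soft gg S) {x y : C(X, ℝ)}
    (hx : x ∈ Mset gg) (hy : y ∈ S) (h : ∀ t, x t ≤ y t) : x ∈ S := by
  obtain ⟨z, hz, h1, -⟩ := hS.dir y hy y hy
  refine hS.her x hx z hz (h1.mono (gg.G.sub_mem (Mset_G (hS.sub hz)) (Mset_G hx)) fun t => ?_)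
  have := h t
  simp
  linarith

lemma PosM.sub_sup {gg : GoodGroup X t0} {x y z : C(X, ℝ)} (hx : x ∈ gg.G) (hy : y ∈ gg.G)
    (hz : z ∈ gg.G) (h1 : PosM gg (z - x)) (h2 : PosM gg (z - y)) : PosM gg (z - x ⊔ y) := by
  refine (h1.inf h2).mono (gg.G.sub_mem hz (gg.sup_mem _ _ hx hy)) fun t => ?_
  simp only [ContinuousMap.inf_apply, ContinuousMap.sub_apply, ContinuousMap.sup_apply]
  rcases le_total (x t) (y t) with h | h
  · rw [sup_eq_right.2 h]; exact inf_le_right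
  · rw [sup_eq_left.2 h]; exact inf_le_left

lemma Mset.sup {gg : GoodGroup X t0} {z w : C(X, ℝ)} (h : z ∈ Mset gg) (h' : w ∈ Mset gg) :
    z ⊔ w ∈ Mset gg := by
  rcases (mem_Mset_iff gg z).1 h with rfl | h
  · rw [sup_eq_right.2]
    · exact h'
    · intro t; exact Mset_nonneg h' t
  · refine (h.mono (gg.sup_mem _ _ h.1 (Mset_G h')) fun t => ?_).mem
    simp

lemma Soft.key [T1Space X] {gg : GoodGroup X t0} {S : Set C(X, ℝ)} (hS : Soft gg S)
    (u v : ℕ → C(X, ℝ)) (hu : ∀ k, u k ∈ S) (hv : ∀ k, v k ∈ S)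
    (mu : ∀ i j, i ≤ j → ∀ t, u i t ≤ u j t) (mv : ∀ i j, i ≤ j → ∀ t, v i t ≤ v j t)
    (V : Set X) (hV : IsOpen V) (h0 : t0 ∈ V) (k0 : ℕ)
    (cu : ∀ k, k0 ≤ k → ∀ t ∈ V, u k t = u k0 t) (cv : ∀ k, k0 ≤ k → ∀ t ∈ V, v k t = v k0 t) :
    ∃ w, PosM gg w ∧ ∀ r ∈ Mset gg, (∀ t, r t ≤ w t) → ∀ k, u k ⊔ v k + r ∈ S := by
  have GS : ∀ {x}, x ∈ S → x ∈ gg.G := fun h => Mset_G (hS.sub h)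
  obtain ⟨y0, hy0, h1, h2⟩ := hS.dir _ (hu k0) _ (hv k0)
  have hd := PosM.sub_sup (GS (hu k0)) (GS (hv k0)) (GS hy0) h1 h2
  obtain ⟨b, hb, hbV⟩ := exists_bump gg V hV h0
  refine ⟨_, hd.inf hb, fun r hr hrw => ?_⟩
  have main : ∀ k, k0 ≤ k → u k ⊔ v k + r ∈ S := by
    intro k hk
    obtain ⟨y1, hy1, h3, h4⟩ := hS.dir _ (hu k) _ (hv k)
    obtain ⟨y, hy, h5, h6⟩ := hS.dir _ hy1 _ hy0
    refine hS.her_le (Mset.add (Mset.sup (hS.sub (hu k)) (hS.sub (hv k))) hr) hy fun t => ?_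
    have e1 := h3.le t
    have e2 := h4.le t
    have e3 := h5.le t
    have e4 := h6.le t
    have e5 := hrw t
    simp only [ContinuousMap.inf_apply, ContinuousMap.sub_apply, ContinuousMap.sup_apply,
      ContinuousMap.add_apply, le_inf_iff] at e5 ⊢
    by_cases ht : t ∈ V
    · rw [cu k hk t ht, cv k hk t ht]
      linarith [e5.1]
    · rw [hbV t ht] at e5
      have := sup_le (e1.trans e3) (e2.trans e3)
      linarith [e5.2]
  intro k
  rcases le_total k0 k with h | h
  · exact main k h
  · refine hS.her_le (Mset.add (Mset.sup (hS.sub (hu k)) (hS.sub (hv k))) hr) (main k0 le_rfl)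
      fun t => ?_
    simp only [ContinuousMap.sup_apply, ContinuousMap.add_apply]
    have := sup_le_sup (mu k k0 h t) (mv k k0 h t)
    linarith

lemma Soft.nFold {gg : GoodGroup X t0} {S : Set C(X, ℝ)} (hS : Soft gg S) {n : ℕ} (hn : 1 ≤ n) :
    nFold n S = {x ∈ Mset gg | ((1 / n : ℚ) : ℝ) • x ∈ S} := by
  have hnq : (0 : ℚ) < 1 / n := by positivity
  have hnr : (0 : ℝ) < n := by positivity
  ext x
  constructor
  · rintro ⟨y, hy, rfl⟩
    have hM : ∑ i, y i ∈ Mset gg := by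
      have : ∀ s : Finset (Fin n), ∑ i ∈ s, y i ∈ Mset gg := by
        intro s
        induction s using Finset.cons_induction with
        | empty => simpa using zero_mem_Mset gg
        | cons a s ha ih => rw [Finset.sum_cons]; exact Mset.add (hS.sub (hy a)) ih
      exact this _
    refine ⟨hM, ?_⟩
    have : ∀ s : Finset (Fin n), ∃ z ∈ S, ∀ i ∈ s, ∀ t, y i t ≤ z t := by
      intro s
      induction s using Finset.cons_induction with
      | empty => exact ⟨0, hS.zero, by simp⟩
      | cons a s ha ih =>
        obtain ⟨z, hz, h⟩ := ih
        obtain ⟨z', hz', h1, h2⟩ := hS.dir _ hz _ (hy a)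
        refine ⟨z', hz', fun i hi t => ?_⟩
        rcases Finset.mem_cons.1 hi with rfl | hi
        · exact h2.le t
        · exact (h i hi t).trans (h1.le t)
    obtain ⟨z, hz, h⟩ := this Finset.univ
    refine hS.her_le (Mset.smul hM hnq) hz fun t => ?_
    have h1 : ∑ i, y i t ≤ ∑ i : Fin n, z t := Finset.sum_le_sum fun i _ => h i (Finset.mem_univ i) t
    simp only [Finset.sum_const, Finset.card_univ, Fintype.card_fin, nsmul_eq_mul] at h1
    simp only [ContinuousMap.smul_apply, ContinuousMap.sum_apply, smul_eq_mul]
    push_cast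
    rw [one_div, inv_mul_le_iff₀ hnr]
    exact h1
  · rintro ⟨hx, h⟩
    refine ⟨fun _ => ((1 / n : ℚ) : ℝ) • x, fun _ => h, ?_⟩
    ext t
    simp
    field_simp

lemma Soft.scale {gg : GoodGroup X t0} {S : Set C(X, ℝ)} (hS : Soft gg S) {q : ℚ} (hq : 0 < q) :
    Soft gg {x ∈ Mset gg | (q : ℝ) • x ∈ S} := by
  have hqr : (0 : ℝ) < q := by exact_mod_cast hq
  refine ⟨fun x hx => hx.1, ⟨zero_mem_Mset gg, by simpa using hS.zero⟩, ?_, ?_⟩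
  · rintro x hx y ⟨hy, hy'⟩ h
    refine ⟨hx, hS.her _ (Mset.smul hx hq) _ hy' ?_⟩
    rw [← smul_sub]
    exact h.smul hq
  · rintro x ⟨hx, hx'⟩ y ⟨hy, hy'⟩
    obtain ⟨z, hz, h1, h2⟩ := hS.dir _ hx' _ hy'
    have hqi : 0 < q⁻¹ := inv_pos.2 hq
    have e : ∀ x : C(X, ℝ), ((q⁻¹ : ℚ) : ℝ) • (q : ℝ) • x = x := by
      intro x; rw [smul_smul]; push_cast; rw [inv_mul_cancel₀ hqr.ne', one_smul]
    refine ⟨((q⁻¹ : ℚ) : ℝ) • z, ⟨Mset.smul (hS.sub hz) hqi, ?_⟩, ?_, ?_⟩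
    · rw [smul_comm, e]; exact hz
    · have := h1.smul hqi
      rwa [smul_sub, e] at this
    · have := h2.smul hqi
      rwa [smul_sub, e] at this

variable [CompactSpace X] [TopologicalSpace.MetrizableSpace X] [Infinite X]

/-- the class of `[0, f0]` is dominated by a multiple of any nonzero
local interval. -/
theorem statement_2 (ht0 : Filter.NeBot (𝓝[≠] t0)) (gg : GoodGroup X t0)
    (f : C(X, ℝ)) (hfM : f ∈ Mset gg) (hf : f ≠ 0) (hff0 : leM gg f gg.f0)
    (E : Set C(X, ℝ)) (hE : IsInterval gg f E) (hEne : E ≠ {0}) :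
    ∃ f' ∈ Mset gg, f' ≠ 0 ∧ leM gg f' f ∧ ∃ n : ℕ, 1 ≤ n ∧
      ∃ F : Set C(X, ℝ), IsInterval gg f' F ∧
        ({g ∈ Mset gg | leM gg g gg.f0} ∩ Nf gg f') + F
          = nFold n (E ∩ Nf gg f') := by
  have hfP := Mset.pos hfM hf
  have ff0 : ∀ t, f t ≤ gg.f0 t := leM_le hff0
  obtain ⟨hEn, hEsub, hEher, hEdir⟩ := hE
  have h0E : (0 : C(X, ℝ)) ∈ E := by
    obtain ⟨e, he⟩ := hEn
    refine hEher 0 ((mem_Nf_iff hfP _).2 ⟨zero_mem_Mset gg, 0, by simp⟩) e he ?_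
    exact ⟨e, (hEsub he).1, by simp⟩
  obtain ⟨e, he, hene⟩ : ∃ e ∈ E, e ≠ 0 := by
    by_contra! hc
    exact hEne (Set.eq_singleton_iff_unique_mem.2 ⟨h0E, hc⟩)
  have heN := hEsub he
  have heP := Mset.pos heN.1 hene
  have vanish : ∀ x ∈ Nf gg f, x t0 = 0 := by
    intro x hx
    obtain ⟨hxM, k, hk⟩ := (mem_Nf_iff hfP x).1 hx
    have a1 := hk t0
    have a2 : f t0 = 0 := le_antisymm (by simpa [gg.f0_zero] using ff0 t0) (hfP.2.1 t0)
    rw [a2, mul_zero] at a1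
    exact le_antisymm a1 (Mset_nonneg hxM t0)
  obtain ⟨V, hV, h0V, mu, hmu, heV⟩ := heP.slope (vanish e heN)
  have hVe : ∀ᶠ t in 𝓝[≠] t0, t ∈ V := mem_nhdsWithin_of_mem_nhds (hV.mem_nhds h0V)
  have hne : ∀ᶠ t in 𝓝[≠] t0, t ≠ t0 := self_mem_nhdsWithin
  obtain ⟨t1, ht1, ht1V, ht1ne⟩ := (heP.2.2.and (hVe.and hne)).exists
  obtain ⟨b, hb, hbV⟩ := exists_bump gg (V \ {t1}) (hV.sdiff isClosed_singleton)
    ⟨h0V, fun h => ht1ne (by simpa using h.symm)⟩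
  obtain ⟨f', hf'P, hf'⟩ := (hb.inf hfP).half
  have f'b : ∀ t, f' t ≤ b t / 2 := fun t => by
    rw [hf' t]; simp only [ContinuousMap.inf_apply]
    linarith [inf_le_left (a := b t) (b := f t)]
  have f'f : ∀ t, f' t ≤ f t / 2 := fun t => by
    rw [hf' t]; simp only [ContinuousMap.inf_apply]
    linarith [inf_le_right (a := b t) (b := f t)]
  have f'V : ∀ t, t ∉ V \ {t1} → f' t = 0 := fun t ht => by
    have := f'b t
    rw [hbV t ht] at this
    exact le_antisymm (by linarith) (hf'P.2.1 t)
  have hf'M := hf'P.mem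
  have hf'f : leM gg f' f := by
    obtain ⟨w, hw, hw'⟩ := hfP.half
    refine (leM_iff _ _ _).2 (Or.inr (hw.mono (gg.G.sub_mem hfP.1 hf'P.1) fun t => ?_))
    have := f'f t
    simp only [ContinuousMap.sub_apply, hw' t]
    linarith
  have heN' : e ∉ Nf gg f' := by
    intro h
    obtain ⟨-, k, hk⟩ := (mem_Nf_iff hf'P e).1 h
    have := hk t1
    rw [f'V t1 (by simp)] at this
    linarith
  have Nher : ∀ x ∈ Mset gg, ∀ y ∈ Nf gg f', (∀ t, x t ≤ y t) → x ∈ Nf gg f' := by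
    intro x hx y hy h
    obtain ⟨-, k, hk⟩ := (mem_Nf_iff hf'P y).1 hy
    exact (mem_Nf_iff hf'P x).2 ⟨hx, k, fun t => (h t).trans (hk t)⟩
  have Nher2 : ∀ x ∈ Mset gg, ∀ y ∈ E, leM gg x y → x ∈ E := by
    intro x hx y hy h
    obtain ⟨-, k, hk⟩ := (mem_Nf_iff hfP y).1 (hEsub hy)
    exact hEher x ((mem_Nf_iff hfP x).2 ⟨hx, k, fun t => (leM_le h t).trans (hk t)⟩) y hy h
  have h0N' : (0 : C(X, ℝ)) ∈ Nf gg f' :=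
    (mem_Nf_iff hf'P _).2 ⟨zero_mem_Mset gg, 0, by simp⟩
  -- the soft interval
  have hS' : Soft gg (E ∩ Nf gg f') := by
    refine ⟨fun x hx => hx.2.1, ⟨h0E, h0N'⟩, ?_, ?_⟩
    · rintro x hx y ⟨hy, hy'⟩ h
      exact ⟨Nher2 x hx y hy ((leM_iff _ _ _).2 (Or.inr h)), Nher x hx y hy' h.le⟩
    · rintro x ⟨hx, hx'⟩ y ⟨hy, hy'⟩
      obtain ⟨d1, hd1, hxd1, hyd1⟩ := hEdir x hx y hy
      obtain ⟨d, hd, hd1d, hed⟩ := hEdir d1 hd1 e he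
      have hdN : d ∉ Nf gg f' := fun h => heN' (Nher e heN.1 d h (leM_le hed))
      have hdM := (hEsub hd).1
      have P : ∀ z ∈ Nf gg f', leM gg z d1 → PosM gg (d - z) := by
        intro z hz hzd1
        have hzd : leM gg z d := by
          obtain ⟨z1, hz1, e1⟩ := hzd1
          obtain ⟨z2, hz2, e2⟩ := hd1d
          exact ⟨z1 + z2, Mset.add hz1 hz2, by rw [e2, e1, add_assoc]⟩
        rcases (leM_iff _ _ _).1 hzd with rfl | h
        · exact absurd hz hdN
        · exact h
      have hsup := PosM.sub_sup (Mset_G hx'.1) (Mset_G hy'.1) (Mset_G hdM)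
        (P x hx' hxd1) (P y hy' hyd1)
      obtain ⟨w, hw, hw'⟩ := (hf'P.inf hsup).half
      have hzM : x ⊔ y + w ∈ Mset gg := Mset.add (Mset.sup hx'.1 hy'.1) hw.mem
      have w1 : ∀ t, w t ≤ f' t := fun t => by
        have a := (hf'P.inf hsup).2.1 t
        have c : (f' ⊓ (d - x ⊔ y)) t ≤ f' t := inf_le_left
        rw [hw' t]; linarith
      have w2 : ∀ t, w t + w t ≤ (d - x ⊔ y) t := fun t => by
        have c : (f' ⊓ (d - x ⊔ y)) t ≤ (d - x ⊔ y) t := inf_le_right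
        rw [hw' t]; linarith
      refine ⟨x ⊔ y + w, ⟨Nher2 _ hzM d hd ((leM_iff _ _ _).2 (Or.inr ?_)), ?_⟩, ?_, ?_⟩
      · refine hw.mono (gg.G.sub_mem (Mset_G hdM) (Mset_G hzM)) fun t => ?_
        have := w2 t
        simp only [ContinuousMap.sub_apply, ContinuousMap.sup_apply,
          ContinuousMap.add_apply] at this ⊢
        linarith
      · obtain ⟨-, k, hk⟩ := (mem_Nf_iff hf'P x).1 hx'
        obtain ⟨-, l, hl⟩ := (mem_Nf_iff hf'P y).1 hy'
        refine (mem_Nf_iff hf'P _).2 ⟨hzM, k + l + 1, fun t => ?_⟩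
        have a1 := hk t
        have a2 := hl t
        have a3 := w1 t
        have a4 : 0 ≤ (k : ℝ) * f' t := mul_nonneg (by positivity) (hf'P.2.1 t)
        have a5 : 0 ≤ (l : ℝ) * f' t := mul_nonneg (by positivity) (hf'P.2.1 t)
        have a6 : x t ⊔ y t ≤ k * f' t + l * f' t := sup_le (by linarith) (by linarith)
        simp only [ContinuousMap.sup_apply, ContinuousMap.add_apply]
        push_cast
        linarith
      · refine hw.mono (gg.G.sub_mem (Mset_G hzM) (Mset_G hx'.1)) fun t => ?_
        simp only [ContinuousMap.sub_apply, ContinuousMap.sup_apply, ContinuousMap.add_apply]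
        linarith [le_sup_left (a := x t) (b := y t)]
      · refine hw.mono (gg.G.sub_mem (Mset_G hzM) (Mset_G hy'.1)) fun t => ?_
        simp only [ContinuousMap.sub_apply, ContinuousMap.sup_apply, ContinuousMap.add_apply]
        linarith [le_sup_right (a := x t) (b := y t)]
  obtain ⟨n, hn⟩ := exists_nat_gt (1 / (mu : ℝ))
  have hmur : (0 : ℝ) < mu := by exact_mod_cast hmu
  have hn0 : (0 : ℝ) < n := lt_trans (by positivity) hn
  have hn1 : 1 ≤ n := by exact_mod_cast hn0
  have hnq : (0 : ℚ) < 1 / n := by positivity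
  have hnmu : (1 : ℝ) / n < mu := by
    rw [div_lt_iff₀ hmur] at hn
    rw [div_lt_iff₀ hn0]; linarith
  refine ⟨f', hf'M, hf'P.ne, hf'f, n, hn1, ?_⟩
  rw [hS'.nFold hn1]
  have hS := hS'.scale hnq
  have hSN : ∀ x ∈ {x ∈ Mset gg | ((1 / n : ℚ) : ℝ) • x ∈ E ∩ Nf gg f'}, x ∈ Nf gg f' := by
    rintro x ⟨hx, -, h⟩
    obtain ⟨-, k, hk⟩ := (mem_Nf_iff hf'P _).1 h
    refine (mem_Nf_iff hf'P _).2 ⟨hx, n * k, fun t => ?_⟩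
    have := hk t
    simp only [ContinuousMap.smul_apply, smul_eq_mul] at this
    push_cast at this ⊢
    rw [one_div, inv_mul_le_iff₀ hn0] at this
    linarith
  have hf0P : PosM gg gg.f0 :=
    ⟨gg.f0_mem, gg.f0_nonneg, by
      filter_upwards [self_mem_nhdsWithin] with t ht using gg.f0_pos t ht⟩
  -- the truncations of `f0`
  obtain ⟨p, hp⟩ : ∃ p : ℕ → C(X, ℝ), ∀ k, p k = gg.f0 ⊓ (((k + 1 : ℕ) : ℚ) : ℝ) • f' := ⟨_, fun _ => rfl⟩
  have hpt : ∀ k t, p k t = gg.f0 t ⊓ ((k : ℝ) + 1) * f' t := by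
    intro k t; rw [hp]; simp
  have hpP : ∀ k, PosM gg (p k) := fun k => by
    rw [hp]; exact hf0P.inf (hf'P.smul (by positivity))
  have hpmono : ∀ i j, i ≤ j → ∀ t, p i t ≤ p j t := by
    intro i j hij t
    rw [hpt, hpt]
    have : (i : ℝ) ≤ j := by exact_mod_cast hij
    exact inf_le_inf_left _ (mul_le_mul_of_nonneg_right (by linarith) (hf'P.2.1 t))
  have f't0 : f' t0 = 0 := by
    refine le_antisymm ?_ (hf'P.2.1 t0)
    have := f'f t0
    have := ff0 t0
    rw [gg.f0_zero] at this
    linarith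
  obtain ⟨V0, hV0, h0V0, nu, hnu, hf'V0⟩ := hf'P.slope f't0
  have hnur : (0 : ℝ) < nu := by exact_mod_cast hnu
  obtain ⟨k0, hk0⟩ := exists_nat_gt (1 / (nu : ℝ))
  rw [div_lt_iff₀ hnur] at hk0
  have hpf0 : ∀ k, k0 ≤ k → ∀ t ∈ V0, p k t = gg.f0 t := by
    intro k hk t ht
    rw [hpt, hf'V0 t ht]
    refine inf_eq_left.2 ?_
    have h1 : (k0 : ℝ) ≤ k := by exact_mod_cast hk
    have h2 : 1 ≤ ((k : ℝ) + 1) * nu := by nlinarith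
    nlinarith [gg.f0_nonneg t]
  have hpc : ∀ k, k0 ≤ k → ∀ t ∈ V0, p k t = p k0 t := fun k hk t ht => by
    rw [hpf0 k hk t ht, hpf0 k0 le_rfl t ht]
  have hpS : ∀ k, p k ∈ {x ∈ Mset gg | ((1 / n : ℚ) : ℝ) • x ∈ E ∩ Nf gg f'} := by
    intro k
    have hM := Mset.smul (hpP k).mem hnq
    refine ⟨(hpP k).mem, Nher2 _ hM e he ((leM_iff _ _ _).2 (Or.inr ?_)), ?_⟩
    · have key : ∀ t ∈ V, 1 / (n : ℝ) * p k t ≤ 1 / n * gg.f0 t := fun t ht =>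
        mul_le_mul_of_nonneg_left (by rw [hpt]; exact inf_le_left) (by positivity)
      refine ⟨gg.G.sub_mem heP.1 (Mset_G hM), fun t => ?_, ?_⟩
      · simp only [ContinuousMap.sub_apply, ContinuousMap.smul_apply, smul_eq_mul]
        push_cast
        by_cases ht : t ∈ V
        · have := key t ht
          rw [heV t ht]
          nlinarith [gg.f0_nonneg t]
        · have h1 : p k t = 0 := by
            refine le_antisymm ?_ ((hpP k).2.1 t)
            rw [hpt, f'V t (fun h => ht h.1), mul_zero]
            exact inf_le_right
          rw [h1]
          simpa using heP.2.1 t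
      · have hVn : V ∈ 𝓝[≠] t0 := mem_nhdsWithin_of_mem_nhds (hV.mem_nhds h0V)
        filter_upwards [hVn, self_mem_nhdsWithin] with t ht htne
        have := key t ht
        simp only [ContinuousMap.sub_apply, ContinuousMap.smul_apply, smul_eq_mul]
        push_cast
        rw [heV t ht]
        nlinarith [gg.f0_pos t htne]
    · refine (mem_Nf_iff hf'P _).2 ⟨hM, k + 1, fun t => ?_⟩
      have h1 : p k t ≤ ((k : ℝ) + 1) * f' t := by rw [hpt]; exact inf_le_right
      have h2 : 1 / (n : ℝ) ≤ 1 := by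
        rw [div_le_one hn0]; exact_mod_cast hn1
      simp only [ContinuousMap.smul_apply, smul_eq_mul]
      push_cast
      nlinarith [(hpP k).2.1 t]
  generalize hSdef : {x ∈ Mset gg | ((1 / n : ℚ) : ℝ) • x ∈ E ∩ Nf gg f'} = S at hS hSN hpS ⊢
  refine ⟨{x ∈ Nf gg f' | ∀ k, x + p k ∈ S}, ⟨⟨0, h0N', by simpa using hpS⟩, fun x hx => hx.1,
    ?_, ?_⟩, ?_⟩
  · rintro g hg g' ⟨hg', hgS⟩ hle
    refine ⟨hg, fun k => hS.her_le (Mset.add hg.1 (hpP k).mem) (hgS k) fun t => ?_⟩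
    have := leM_le hle t
    simp only [ContinuousMap.add_apply]
    linarith
  · rintro x ⟨hx, hxS⟩ y ⟨hy, hyS⟩
    obtain ⟨w, hw, hwS⟩ := hS.key (fun k => x + p k) (fun k => y + p k) hxS hyS
      (fun i j hij t => by simpa using hpmono i j hij t)
      (fun i j hij t => by simpa using hpmono i j hij t) V0 hV0 h0V0 k0
      (fun k hk t ht => by simpa using hpc k hk t ht)
      (fun k hk t ht => by simpa using hpc k hk t ht)
    have hzM : x ⊔ y + w ∈ Mset gg := Mset.add (Mset.sup hx.1 hy.1) hw.mem
    have hzS : ∀ k, (x ⊔ y + w) + p k ∈ S := by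
      intro k
      have := hwS w hw.mem (fun _ => le_rfl) k
      convert this using 1
      ext t
      simp only [ContinuousMap.sup_apply, ContinuousMap.add_apply]
      rw [max_add_add_right (x t) (y t) (p k t)]
      ring
    refine ⟨x ⊔ y + w, ⟨Nher _ hzM _ (hSN _ (hzS 0)) fun t => ?_, hzS⟩, ?_, ?_⟩
    · have := (hpP 0).2.1 t
      simp only [ContinuousMap.add_apply]
      linarith
    · refine (leM_iff _ _ _).2 (Or.inr
        (hw.mono (gg.G.sub_mem (Mset_G hzM) (Mset_G hx.1)) fun t => ?_))
      simp only [ContinuousMap.sub_apply, ContinuousMap.sup_apply, ContinuousMap.add_apply]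
      linarith [le_sup_left (a := x t) (b := y t)]
    · refine (leM_iff _ _ _).2 (Or.inr
        (hw.mono (gg.G.sub_mem (Mset_G hzM) (Mset_G hy.1)) fun t => ?_))
      simp only [ContinuousMap.sub_apply, ContinuousMap.sup_apply, ContinuousMap.add_apply]
      linarith [le_sup_right (a := x t) (b := y t)]
  · apply Set.Subset.antisymm
    · rintro _ ⟨a, ⟨⟨haM, haf0⟩, haN⟩, x, ⟨hx, hxS⟩, rfl⟩
      obtain ⟨-, k, hk⟩ := (mem_Nf_iff hf'P a).1 haN
      refine hS.her_le (Mset.add haM hx.1) (hxS k) fun t => ?_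
      have h1 : a t ≤ p k t := by
        rw [hpt]
        have := hf'P.2.1 t
        exact le_inf (leM_le haf0 t) (by linarith [hk t])
      simp only [ContinuousMap.add_apply]
      linarith
    · intro y hy
      by_cases hy0 : y = 0
      · subst hy0
        exact ⟨0, ⟨⟨zero_mem_Mset gg, gg.f0, hf0P.mem, by simp⟩, h0N'⟩, 0,
          ⟨h0N', by simpa using hpS⟩, by simp⟩
      have hyP := Mset.pos (hS.sub hy) hy0
      obtain ⟨w, hw, hwS⟩ := hS.key (fun _ => y) p (fun _ => hy) hpS
        (fun i j hij t => le_rfl) hpmono V0 hV0 h0V0 k0 (fun k hk t ht => rfl) hpc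
      obtain ⟨r, hr, hr'⟩ := (hw.inf (hyP.inf hf0P)).half
      have hrn := hr.2.1
      have r1 : ∀ t, r t ≤ w t := fun t => by
        have c : (w ⊓ (y ⊓ gg.f0)) t ≤ w t := inf_le_left
        linarith [hr' t, hrn t]
      have r2 : ∀ t, r t + r t ≤ (y ⊓ gg.f0) t := fun t => by
        have c : (w ⊓ (y ⊓ gg.f0)) t ≤ (y ⊓ gg.f0) t := inf_le_right
        linarith [hr' t]
      have r3 : ∀ t, (y ⊓ gg.f0) t ≤ y t := fun t => inf_le_left
      have r4 : ∀ t, (y ⊓ gg.f0) t ≤ gg.f0 t := fun t => inf_le_right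
      have hinf := hyP.inf hf0P
      have haP : PosM gg (y ⊓ gg.f0 - r) := hr.mono (gg.G.sub_mem hinf.1 hr.1) fun t => by
        have := r2 t
        rw [ContinuousMap.sub_apply]
        linarith
      have hxP : PosM gg (y - (y ⊓ gg.f0 - r)) :=
        hr.mono (gg.G.sub_mem hyP.1 haP.1) fun t => by
          have := r3 t
          rw [ContinuousMap.sub_apply, ContinuousMap.sub_apply]
          linarith
      refine ⟨y ⊓ gg.f0 - r, ⟨⟨haP.mem, (leM_iff _ _ _).2 (Or.inr ?_)⟩, ?_⟩,
        y - (y ⊓ gg.f0 - r), ⟨?_, fun k => ?_⟩, by simp⟩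
      · refine hr.mono (gg.G.sub_mem gg.f0_mem haP.1) fun t => ?_
        have := r4 t
        rw [ContinuousMap.sub_apply, ContinuousMap.sub_apply]
        linarith
      · refine Nher _ haP.mem y (hSN y hy) fun t => ?_
        rw [ContinuousMap.sub_apply]
        linarith [r3 t, hrn t]
      · refine Nher _ hxP.mem y (hSN y hy) fun t => ?_
        have := haP.2.1 t
        rw [ContinuousMap.sub_apply]
        linarith
      · refine hS.her_le (Mset.add hxP.mem (hpP k).mem) (hwS r hr.mem r1 k) fun t => ?_
        have hpk : p k t ≤ gg.f0 t := by rw [hpt]; exact inf_le_left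
        simp only [ContinuousMap.sub_apply, ContinuousMap.sup_apply, ContinuousMap.add_apply,
          ContinuousMap.inf_apply]
        rcases le_total (y t) (gg.f0 t) with h | h
        · rw [inf_eq_left.2 h]
          linarith [le_sup_right (a := y t) (b := p k t)]
        · rw [inf_eq_right.2 h]
          linarith [le_sup_left (a := y t) (b := p k t)]
end

section
/- Let f ∈ M be nonzero with f ≤_M f0 and let h ∈ L_f be nonzero. Then I_f(h) = {g ∈ N_f : g ≤ h on U_f, and there exist g' ∈ N_f and an open neighbourhood V of t0 such that g(t) < g'(t) and g'(t) < h(t) for all t ∈ (V \ {t0}) ∩ U_f}, and also I_f(h) = {g ∈ N_f : there exists z ∈ N_f with g <_M z and z ≤ h on U_f}. -/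
open Topology Set Pointwise

variable {X : Type*} [TopologicalSpace X] {t0 : X}

theorem aux_M_G {X : Type*} [TopologicalSpace X] {t0 : X} (gg : GoodGroup X t0) {g : C(X, ℝ)}
    (hg : g ∈ Mset gg) : g ∈ gg.G ∧ ∀ t, 0 ≤ g t := by
  rcases hg with rfl | ⟨h1, h2, _⟩
  · exact ⟨gg.G.zero_mem, fun t => le_of_eq (by simp)⟩
  · exact ⟨h1, h2⟩

theorem aux_M_nz {X : Type*} [TopologicalSpace X] {t0 : X} (gg : GoodGroup X t0) {g : C(X, ℝ)}
    (hg : g ∈ Mset gg) (h0 : g ≠ 0) :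
    ∃ V : Set X, IsOpen V ∧ t0 ∈ V ∧ ∀ t ∈ V, t ≠ t0 → 0 < g t := by
  rcases hg with h | ⟨_, _, h3⟩
  · exact absurd h h0
  · exact h3

theorem aux_M_add {X : Type*} [TopologicalSpace X] {t0 : X} (gg : GoodGroup X t0) {g k : C(X, ℝ)}
    (hg : g ∈ Mset gg) (hk : k ∈ Mset gg) : g + k ∈ Mset gg := by
  obtain ⟨kG, k0⟩ := aux_M_G gg hk
  rcases hg with rfl | ⟨h1, h2, V, hV, hVt, hpos⟩
  · simpa using hk
  · refine Or.inr ⟨gg.G.add_mem h1 kG, fun t => add_nonneg (h2 t) (k0 t), V, hV, hVt, ?_⟩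
    intro t ht htn
    exact add_pos_of_pos_of_nonneg (hpos t ht htn) (k0 t)

theorem aux_leM_le {X : Type*} [TopologicalSpace X] {t0 : X} (gg : GoodGroup X t0) {g k : C(X, ℝ)}
    (h : leM gg g k) (t : X) : g t ≤ k t := by
  obtain ⟨z, hz, rfl⟩ := h
  have := (aux_M_G gg hz).2 t
  simpa using this

theorem aux_Nf_le {X : Type*} [TopologicalSpace X] {t0 : X} (gg : GoodGroup X t0) {f g : C(X, ℝ)}
    (hg : g ∈ Nf gg f) : ∃ n : ℕ, ∀ t, g t ≤ n * f t := by
  obtain ⟨_, n, _, hn⟩ := hg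
  refine ⟨n, fun t => ?_⟩
  simpa using aux_leM_le gg hn t

theorem aux_Nf_of {X : Type*} [TopologicalSpace X] {t0 : X} (gg : GoodGroup X t0) {f g : C(X, ℝ)}
    (hf : f ∈ Mset gg) (hf0 : f ≠ 0) (hg : g ∈ Mset gg) (n : ℕ) (hn : ∀ t, g t ≤ n * f t) :
    g ∈ Nf gg f := by
  obtain ⟨V, hV, hVt, hpos⟩ := aux_M_nz gg hf hf0
  obtain ⟨fG, f0⟩ := aux_M_G gg hf
  refine ⟨hg, n + 1, by omega, (n + 1) • f - g, Or.inr ⟨?_, ?_, V, hV, hVt, ?_⟩, by abel⟩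
  · exact gg.G.sub_mem (gg.G.nsmul_mem fG _) (aux_M_G gg hg).1
  · intro t
    have := hn t
    have := f0 t
    simp
    linarith
  · intro t ht htn
    have := hn t
    have := hpos t ht htn
    simp
    linarith

theorem aux_half {X : Type*} [TopologicalSpace X] {t0 : X} (gg : GoodGroup X t0)
    {f g z : C(X, ℝ)} (hf : f ∈ Mset gg) (hf0 : f ≠ 0) (hg : g ∈ Nf gg f) (hz : z ∈ Nf gg f)
    (hlt : ltM gg g z) : ∃ y ∈ Nf gg f, ltM gg g y ∧ (∀ t, y t ≤ z t) ∧ (∀ t, g t ≤ z t) ∧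
      ∃ V : Set X, IsOpen V ∧ t0 ∈ V ∧ ∀ t ∈ V, t ≠ t0 → g t < y t ∧ y t < z t := by
  have hle := aux_leM_le gg hlt.1
  obtain ⟨⟨w, hw, rfl⟩, hne⟩ := hlt
  have hw0 : w ≠ 0 := by
    rintro rfl
    simp at hne
  obtain ⟨V, hV, hVt, hpos⟩ := aux_M_nz gg hw hw0
  obtain ⟨wG, w0⟩ := aux_M_G gg hw
  have hu : ((1/2 : ℚ) : ℝ) • w ∈ Mset gg := by
    refine Or.inr ⟨gg.rat_smul_mem _ _ wG, fun t => ?_, V, hV, hVt, fun t ht htn => ?_⟩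
    · have := w0 t
      simp
      linarith
    · have := hpos t ht htn
      simp
      linarith
  obtain ⟨n, hn⟩ := aux_Nf_le gg hz
  have hyz : ∀ t, (g + ((1/2 : ℚ) : ℝ) • w) t ≤ (g + w) t := by
    intro t
    have := w0 t
    simp
    linarith
  refine ⟨g + ((1/2 : ℚ) : ℝ) • w, aux_Nf_of gg hf hf0 (aux_M_add gg hg.1 hu) n
    (fun t => (hyz t).trans (hn t)), ⟨⟨_, hu, rfl⟩, ?_⟩, hyz, hle, V, hV, hVt, ?_⟩
  · intro he
    apply hw0
    have h2 : ((1/2 : ℚ) : ℝ) • w = 0 := by simpa using he.symm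
    rcases smul_eq_zero.1 h2 with h3 | h3
    · norm_num at h3
    · exact h3
  · intro t ht htn
    have := hpos t ht htn
    simp
    constructor <;> linarith

theorem aux_BC {X : Type*} [TopologicalSpace X] [T1Space X] {t0 : X}
    (ht0 : Filter.NeBot (𝓝[≠] t0)) (gg : GoodGroup X t0)
    (f : C(X, ℝ)) (hfM : f ∈ Mset gg) (hf : f ≠ 0) (hff0 : leM gg f gg.f0)
    (h : X → ℝ) (g g' : C(X, ℝ)) (hg : g ∈ Nf gg f) (hgh : ∀ t ∈ Uf f, g t ≤ h t)
    (hg' : g' ∈ Nf gg f) (V : Set X) (hV : IsOpen V) (hVt : t0 ∈ V)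
    (hlt : ∀ t ∈ (V \ {t0}) ∩ Uf f, g t < g' t ∧ g' t < h t) :
    ∃ z ∈ Nf gg f, ltM gg g z ∧ ∀ t ∈ Uf f, z t ≤ h t := by
  have hft0 : f t0 = 0 := by
    have h1 := aux_leM_le gg hff0 t0
    rw [gg.f0_zero] at h1
    exact le_antisymm h1 ((aux_M_G gg hfM).2 t0)
  obtain ⟨V1, hV1, hV1t, hpos⟩ := aux_M_nz gg hfM hf
  obtain ⟨U, hU, hKU, hUV, r, rG, hr, hrU, hrV⟩ :=
    gg.urysohn {t0} V isClosed_singleton hV (by simpa using hVt) 1 (by norm_num)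
  have hUt : t0 ∈ U := hKU rfl
  obtain ⟨gG, g0⟩ := aux_M_G gg hg.1
  obtain ⟨g'G, g'0⟩ := aux_M_G gg hg'.1
  set w : C(X, ℝ) := ((g' - g) ⊔ 0) ⊓ r with hw
  have wG : w ∈ gg.G :=
    gg.inf_mem _ _ (gg.sup_mem _ _ (gg.G.sub_mem g'G gG) gg.G.zero_mem) rG
  have wt : ∀ t, w t = min (max (g' t - g t) 0) (r t) := fun t => by simp [hw]
  have wpos : ∀ t ∈ U ∩ V1, t ≠ t0 → 0 < w t := by
    intro t ht htn
    have h1 := hpos t ht.2 htn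
    have h2 := hlt t ⟨⟨hUV ht.1, htn⟩, h1.ne'⟩
    rw [wt, hrU t ht.1]
    refine lt_min (lt_max_of_lt_left (by linarith)) (by norm_num)
  have wM : w ∈ Mset gg := by
    refine Or.inr ⟨wG, fun t => ?_, U ∩ V1, hU.inter hV1, ⟨hUt, hV1t⟩, wpos⟩
    rw [wt]
    exact le_min (le_max_right _ _) (hr t).1
  have w0 : w ≠ 0 := by
    intro h0
    have hm : U ∩ V1 ∈ 𝓝[≠] t0 :=
      mem_nhdsWithin_of_mem_nhds ((hU.inter hV1).mem_nhds ⟨hUt, hV1t⟩)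
    obtain ⟨t, ht, htn⟩ := Filter.nonempty_of_mem (Filter.inter_mem hm self_mem_nhdsWithin)
    have := wpos t ht htn
    rw [h0] at this
    simp at this
  have hz : ∀ t, (g + w) t ≤ max (g t) (g' t) := by
    intro t
    have h1 : w t ≤ max (g' t - g t) 0 := by rw [wt]; exact min_le_left _ _
    rcases le_max_iff.1 h1 with h2 | h2
    · exact le_max_of_le_right (by simp; linarith)
    · exact le_max_of_le_left (by simp; linarith)
  obtain ⟨n, hn⟩ := aux_Nf_le gg hg
  obtain ⟨m, hm⟩ := aux_Nf_le gg hg'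
  refine ⟨g + w, aux_Nf_of gg hfM hf (aux_M_add gg hg.1 wM) (n + m) ?_, ⟨⟨w, wM, rfl⟩, ?_⟩, ?_⟩
  · intro t
    refine (hz t).trans (max_le ?_ ?_)
    · have := hn t
      have := hm t
      have := g'0 t
      push_cast
      linarith
    · have := hn t
      have := hm t
      have := g0 t
      push_cast
      linarith
  · intro he
    exact w0 (by simpa using he.symm)
  · intro t ht
    have htn : t ≠ t0 := by
      rintro rfl
      exact ht hft0
    by_cases hv : t ∈ V
    · exact (hz t).trans (max_le (hgh t ht) (hlt t ⟨⟨hv, htn⟩, ht⟩).2.le)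
    · have h1 : w t ≤ 0 := by
        rw [wt, hrV t hv]
        exact min_le_right _ _
      have := hgh t ht
      simp
      linarith

variable [CompactSpace X] [TopologicalSpace.MetrizableSpace X] [Infinite X]

/-- the two alternative descriptions of `I_f(h)`. -/
theorem statement_3 (ht0 : Filter.NeBot (𝓝[≠] t0)) (gg : GoodGroup X t0)
    (f : C(X, ℝ)) (hfM : f ∈ Mset gg) (hf : f ≠ 0) (hff0 : leM gg f gg.f0)
    (h : X → ℝ) (hh : MemLfNZ gg f h) :
    Iset gg f h = {g ∈ Nf gg f | (∀ t ∈ Uf f, g t ≤ h t) ∧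
        ∃ g' ∈ Nf gg f, ∃ V : Set X, IsOpen V ∧ t0 ∈ V ∧
          ∀ t ∈ (V \ {t0}) ∩ Uf f, g t < g' t ∧ g' t < h t} ∧
    Iset gg f h = {g ∈ Nf gg f | ∃ z ∈ Nf gg f, ltM gg g z ∧
        ∀ t ∈ Uf f, z t ≤ h t} := by
  have hAC : Iset gg f h = {g ∈ Nf gg f | ∃ z ∈ Nf gg f, ltM gg g z ∧
        ∀ t ∈ Uf f, z t ≤ h t} := by
    ext g
    constructor
    · rintro (rfl | ⟨hg, z, hz, hlt, hle, _⟩)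
      · obtain ⟨_, _, _, z, hz, hz0, hzh⟩ := hh
        refine ⟨aux_Nf_of gg hfM hf (Or.inl rfl) 0 (by simp), z, hz, ⟨⟨z, hz.1, by simp⟩, ?_⟩, hzh⟩
        exact hz0.symm
      · exact ⟨hg, z, hz, hlt, hle⟩
    · rintro ⟨hg, z, hz, hlt, hle⟩
      obtain ⟨y, hy, hgy, hyz, _, V, hV, hVt, hp⟩ := aux_half gg hfM hf hg hz hlt
      exact Or.inr ⟨hg, y, hy, hgy, fun t ht => (hyz t).trans (hle t ht), V, hV, hVt,
        fun t ht => (hp t ht.1.1 ht.1.2).2.trans_le (hle t ht.2)⟩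
  refine ⟨?_, hAC⟩
  rw [hAC]
  ext g
  constructor
  · rintro ⟨hg, z, hz, hlt, hle⟩
    obtain ⟨y, hy, hgy, hyz, hgz, V, hV, hVt, hp⟩ := aux_half gg hfM hf hg hz hlt
    exact ⟨hg, fun t ht => (hgz t).trans (hle t ht), y, hy, V, hV, hVt,
      fun t ht => ⟨(hp t ht.1.1 ht.1.2).1, (hp t ht.1.1 ht.1.2).2.trans_le (hle t ht.2)⟩⟩
  · rintro ⟨hg, hgh, g', hg', V, hV, hVt, hlt⟩
    exact ⟨hg, aux_BC ht0 gg f hfM hf hff0 h g g' hg hgh hg' V hV hVt hlt⟩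
end

section
/- Let f ∈ M be nonzero with f ≤_M f0 and let h ∈ L_f. Then h is the pointwise supremum of I_f(h); that is, h(t) = sup{g(t) : g ∈ I_f(h)} for every t ∈ U_f. -/
open Topology Set Pointwise

variable {X : Type*} [TopologicalSpace X] {t0 : X}

theorem aux_Nf (gg : GoodGroup X t0) (f z0 r : C(X, ℝ)) (hfG : f ∈ gg.G) (hfn : ∀ t, 0 ≤ f t)
    (hft : f t0 = 0) (δ ρ : ℝ) (hδ : 0 < δ) (hz0 : z0 ∈ gg.G) (hz0n : ∀ t, 0 ≤ z0 t)
    (V : Set X) (hV : IsOpen V) (htV : t0 ∈ V) (hzp : ∀ t ∈ V, t ≠ t0 → 0 < z0 t)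
    (n0 : ℕ) (hn0 : ∀ t, z0 t ≤ n0 * f t) (hr : r ∈ gg.G)
    (hr0 : ∀ t, 0 ≤ r t ∧ r t ≤ ρ) (hrz : ∀ t, f t ≤ δ → r t = 0)
    (a : ℚ) (ha : 0 < a) (ha1 : a < 1) : ((a : ℝ) • z0) ⊔ r ∈ Nf gg f := by
  have haR : (0 : ℝ) < a := by exact_mod_cast ha
  have haR1 : (a : ℝ) < 1 := by exact_mod_cast ha1
  have hG : ((a : ℝ) • z0) ⊔ r ∈ gg.G := gg.sup_mem _ _ (gg.rat_smul_mem a _ hz0) hr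
  refine ⟨Or.inr ⟨hG, ?_, V, hV, htV, ?_⟩, ?_⟩
  · intro t
    exact le_trans (hr0 t).1 le_sup_right
  · intro t ht hne
    have := mul_pos haR (hzp t ht hne)
    exact lt_of_lt_of_le this (le_sup_left (a := (a : ℝ) * z0 t) (b := r t))
  obtain ⟨m, hm⟩ := exists_nat_ge (ρ / δ)
  rw [div_le_iff₀ hδ] at hm
  refine ⟨n0 + m + 1, by omega, ((n0 + m + 1) • f) - (((a : ℝ) • z0) ⊔ r), Or.inr ⟨?_, ?_, ?_⟩, by abel⟩
  · exact gg.G.sub_mem (gg.G.nsmul_mem hfG _) hG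
  · intro t
    have h1 := hn0 t
    have h2 := hz0n t
    have h3 := hfn t
    have h4 := hr0 t
    have hm0 : (0 : ℝ) ≤ m * f t := by positivity
    have hn00 : (0 : ℝ) ≤ n0 * f t := by positivity
    have : (a : ℝ) * z0 t ⊔ r t ≤ (n0 + m + 1 : ℝ) * f t := by
      apply sup_le
      · nlinarith
      · rcases le_or_gt (f t) δ with h5 | h5
        · rw [hrz t h5]; positivity
        · have : (m : ℝ) * δ ≤ m * f t := by gcongr
          nlinarith
    simpa using this
  · refine ⟨V ∩ {t | f t < δ}, hV.inter (isOpen_lt f.continuous continuous_const),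
      ⟨htV, by simpa [hft] using hδ⟩, ?_⟩
    rintro t ⟨ht, ht'⟩ hne
    have h0 := hzp t ht hne
    have h1 := hn0 t
    have h3 := hfn t
    have hm0 : (0 : ℝ) ≤ m * f t := by positivity
    have hn00 : (0 : ℝ) ≤ n0 * f t := by positivity
    have : (a : ℝ) * z0 t ⊔ r t < (n0 + m + 1 : ℝ) * f t := by
      rw [hrz t (le_of_lt ht')]
      apply sup_lt_iff.2
      constructor <;> nlinarith
    simpa using this

variable [CompactSpace X] [TopologicalSpace.MetrizableSpace X] [Infinite X]

/-- `h` is the pointwise supremum of `I_f(h)`. -/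
theorem statement_5 (ht0 : Filter.NeBot (𝓝[≠] t0)) (gg : GoodGroup X t0)
    (f : C(X, ℝ)) (hfM : f ∈ Mset gg) (hf : f ≠ 0) (hff0 : leM gg f gg.f0)
    (h : X → ℝ) (hh : MemLf gg f h) :
    ∀ t ∈ Uf f, h t = sSup {r : ℝ | ∃ g ∈ Iset gg f h, g t = r} := by
  have leM_le : ∀ {a b : C(X, ℝ)}, leM gg a b → ∀ t, a t ≤ b t := by
    rintro a b ⟨z, hz, rfl⟩ t
    have : 0 ≤ z t := by
      rcases hz with rfl | hz
      · simp
      · exact hz.2.1 t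
    simpa using this
  obtain ⟨hfG, hfn, -⟩ := hfM.resolve_left hf
  have hft : f t0 = 0 := le_antisymm (by simpa [gg.f0_zero] using leM_le hff0 t0) (hfn t0)
  obtain ⟨hcont, -, hpos, hor⟩ := hh
  intro t ht
  have hUo : IsOpen (Uf f) := isOpen_ne_fun f.continuous continuous_const
  have hub : ∀ r ∈ {r : ℝ | ∃ g ∈ Iset gg f h, g t = r}, r ≤ h t := by
    rintro _ ⟨g, rfl | ⟨-, z, -, hgz, hz, -⟩, rfl⟩
    · simpa using hpos t ht
    · exact (leM_le hgz.1 t).trans (hz t ht)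
  have hbdd : BddAbove {r : ℝ | ∃ g ∈ Iset gg f h, g t = r} := ⟨h t, hub⟩
  have h0mem : (0 : ℝ) ∈ {r : ℝ | ∃ g ∈ Iset gg f h, g t = r} := ⟨0, Or.inl rfl, rfl⟩
  refine le_antisymm (le_of_forall_lt_imp_le_of_dense fun c hc => ?_) (csSup_le ⟨0, h0mem⟩ hub)
  rcases lt_or_ge c 0 with hc0 | hc0
  · exact hc0.le.trans (le_csSup hbdd h0mem)
  rcases hor with hz | ⟨z0, ⟨hz0M, n0, -, hn0⟩, hz0, hz0h⟩
  · exact absurd (hz t ht) (by linarith)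
  obtain ⟨hz0G, hz0n, V, hV, htV, hzp⟩ := hz0M.resolve_left hz0
  have hn0' : ∀ t, z0 t ≤ n0 * f t := fun s => by simpa using leM_le hn0 s
  obtain ⟨ρ, hρ1, hρ2⟩ := exists_rat_btwn hc
  have hft' : 0 < f t := lt_of_le_of_ne (hfn t) (Ne.symm ht)
  obtain ⟨W, hW, htW, hWU⟩ : ∃ W : Set X, IsOpen W ∧ t ∈ W ∧
      ∀ s ∈ W, f t / 2 < f s ∧ s ∈ Uf f ∧ (ρ : ℝ) < h s := by
    refine ⟨(Uf f ∩ h ⁻¹' Ioi (ρ : ℝ)) ∩ {s | f t / 2 < f s},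
      (hcont.isOpen_inter_preimage hUo isOpen_Ioi).inter
        (isOpen_lt continuous_const f.continuous), ⟨⟨ht, hρ2⟩, ?_⟩, ?_⟩
    · change f t / 2 < f t
      linarith
    · rintro s ⟨⟨h1, h2⟩, h3⟩
      exact ⟨h3, h1, h2⟩
  have hρ0 : (0 : ℚ) ≤ ρ := by exact_mod_cast hc0.trans hρ1.le
  obtain ⟨U, -, hKU, -, r, hrG, hr0, hrU, hrW⟩ :=
    gg.urysohn {t} W isClosed_singleton hW (by simpa using htW) ρ hρ0
  have hrz : ∀ s, f s ≤ f t / 2 → r s = 0 := fun s hs =>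
    hrW s fun hsW => absurd (hWU s hsW).1 (not_lt.2 hs)
  have key := aux_Nf gg f z0 r hfG hfn hft (f t / 2) ρ (by linarith) hz0G hz0n V hV htV hzp n0
    hn0' hrG hr0 hrz
  have hV' : IsOpen (V ∩ {s | f s < f t / 2}) := hV.inter (isOpen_lt f.continuous continuous_const)
  have htV' : t0 ∈ V ∩ {s | f s < f t / 2} := ⟨htV, by
    change f t0 < f t / 2
    linarith⟩
  have hval : ∀ a : ℚ, 0 < a → ∀ s ∈ V ∩ {s | f s < f t / 2},
      (((a : ℝ) • z0) ⊔ r) s = a * z0 s := by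
    rintro a ha s ⟨hs, hs'⟩
    have haR : (0 : ℝ) < a := by exact_mod_cast ha
    have := hz0n s
    have h1 : 0 ≤ (a : ℝ) * z0 s := by positivity
    have h2 := hrz s (le_of_lt hs')
    simp [h2, h1]
  have hdiff : ∀ s ∈ V ∩ {s | f s < f t / 2}, s ≠ t0 →
      ((((1/4 : ℚ) : ℝ) • z0) ⊔ r) s < ((((1/2 : ℚ) : ℝ) • z0) ⊔ r) s := by
    intro s hs hne
    rw [hval _ (by norm_num) s hs, hval _ (by norm_num) s hs]
    have := hzp s hs.1 hne
    push_cast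
    linarith
  have hg : ((((1/4 : ℚ) : ℝ) • z0) ⊔ r) ∈ Iset gg f h := by
    refine Or.inr ⟨key _ (by norm_num) (by norm_num), (((1/2 : ℚ) : ℝ) • z0) ⊔ r,
      key _ (by norm_num) (by norm_num), ⟨⟨_, Or.inr ⟨?_, ?_, _, hV', htV', ?_⟩,
        (add_sub_cancel _ _).symm⟩, ?_⟩, ?_, _, hV', htV', ?_⟩
    · exact gg.G.sub_mem (gg.sup_mem _ _ (gg.rat_smul_mem _ _ hz0G) hrG)
        (gg.sup_mem _ _ (gg.rat_smul_mem _ _ hz0G) hrG)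
    · intro s
      have := hz0n s
      rw [ContinuousMap.sub_apply, sub_nonneg]
      change ((1/4 : ℚ) : ℝ) * z0 s ⊔ r s ≤ ((1/2 : ℚ) : ℝ) * z0 s ⊔ r s
      apply sup_le_sup_right
      push_cast
      linarith
    · intro s hs hne
      rw [ContinuousMap.sub_apply, sub_pos]
      exact hdiff s hs hne
    · intro heq
      have hn : ∀ᶠ s in 𝓝[≠] t0, s ∈ V ∩ {s | f s < f t / 2} ∧ s ≠ t0 :=
        (Filter.Eventually.filter_mono nhdsWithin_le_nhds (hV'.mem_nhds htV')).and
          self_mem_nhdsWithin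
      obtain ⟨s, hs, hne⟩ := hn.exists
      have := hdiff s hs hne
      rw [heq] at this
      exact lt_irrefl _ this
    · intro s hs
      change ((1/2 : ℚ) : ℝ) * z0 s ⊔ r s ≤ h s
      have h1 := hz0h s hs
      have h2 := hz0n s
      apply sup_le
      · push_cast
        linarith
      · by_cases hsW : s ∈ W
        · exact (hr0 s).2.trans (hWU s hsW).2.2.le
        · rw [hrW s hsW]
          exact hpos s hs
    · rintro s ⟨⟨hs, hne⟩, hsU⟩
      rw [hval _ (by norm_num) s hs]
      have h1 := hz0h s hsU
      have h2 := hzp s hs.1 hne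
      push_cast
      linarith
  have h1 : r t = ρ := hrU t (hKU rfl)
  have h2 : r t ≤ ((((1/4 : ℚ) : ℝ) • z0) ⊔ r) t :=
    le_sup_right (a := ((1/4 : ℚ) : ℝ) * z0 t) (b := r t)
  have h3 := le_csSup hbdd ⟨_, hg, rfl⟩
  linarith
end

section
/- Let f ∈ M be nonzero with f ≤_M f0. Then for every t ∈ U_f, sup{g(t) : g ∈ D_f} = 1. -/
open Topology Set Pointwise

variable {X : Type*} [TopologicalSpace X] {t0 : X}

variable [CompactSpace X] [TopologicalSpace.MetrizableSpace X] [Infinite X]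

/-- the pointwise supremum of `D_f` is `1` on `U_f`. -/
theorem statement_6 (ht0 : Filter.NeBot (𝓝[≠] t0)) (gg : GoodGroup X t0)
    (f : C(X, ℝ)) (hfM : f ∈ Mset gg) (hf : f ≠ 0) (hff0 : leM gg f gg.f0) :
    ∀ t ∈ Uf f, sSup {r : ℝ | ∃ g ∈ Df gg f, g t = r} = 1 := by
  intro t ht
  have hM0 : ∀ z ∈ Mset gg, ∀ s, 0 ≤ z s := by
    rintro z (rfl | h) s
    · simp
    · exact h.2.1 s
  rcases hfM with h0 | ⟨hfG, hfnn, V, hVo, hV0, hVpos⟩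
  · exact absurd h0 hf
  have hft0 : f t0 = 0 := by
    obtain ⟨z, hz, hzz⟩ := hff0
    have h1 := congrArg (fun h : C(X, ℝ) => h t0) hzz
    simp only [ContinuousMap.add_apply, gg.f0_zero] at h1
    have := hM0 z hz t0
    have := hfnn t0
    linarith
  have hone : (1 : C(X, ℝ)) ∈ gg.G := by
    obtain ⟨U, _, hU, _, r, hr, _, h2, _⟩ :=
      gg.urysohn univ univ isClosed_univ isOpen_univ subset_rfl 1 zero_le_one
    have : r = 1 := by
      ext s
      simpa using h2 s (hU (mem_univ s))
    exact this ▸ hr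
  have hftpos : 0 < f t := lt_of_le_of_ne (hfnn t) (Ne.symm ht)
  obtain ⟨n, hn⟩ := exists_nat_gt (1 / f t)
  have hn1 : 1 < (n : ℝ) * f t := by
    rwa [div_lt_iff₀ hftpos] at hn
  have hnpos : (0 : ℝ) < n := lt_trans (by positivity) hn
  let g : C(X, ℝ) := (n • f) ⊓ 1
  have hg : ∀ s, g s = min ((n : ℝ) * f s) 1 := by
    intro s
    simp [g]
  have hgG : g ∈ gg.G := gg.inf_mem _ _ (gg.G.nsmul_mem hfG n) hone
  have hgM : g ∈ Mset gg := by
    refine Or.inr ⟨hgG, fun s => ?_, V, hVo, hV0, fun s hs hst => ?_⟩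
    · rw [hg]
      exact le_min (mul_nonneg hnpos.le (hfnn s)) zero_le_one
    · rw [hg]
      exact lt_min (mul_pos hnpos (hVpos s hs hst)) one_pos
  have hgN : g ∈ Nf gg f := by
    refine ⟨hgM, n + 1, by omega, (n + 1) • f - g, Or.inr
      ⟨gg.G.sub_mem (gg.G.nsmul_mem hfG _) hgG, fun s => ?_, V, hVo, hV0,
        fun s hs hst => ?_⟩, by abel⟩
    · have h1 := min_le_left ((n : ℝ) * f s) 1
      have h2 := hfnn s
      have h3 : ((n + 1) • f - g) s = ((n : ℝ) + 1) * f s - min ((n : ℝ) * f s) 1 := by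
        simp [hg]
      rw [h3]
      nlinarith
    · have h1 := min_le_left ((n : ℝ) * f s) 1
      have h2 := hVpos s hs hst
      have h3 : ((n + 1) • f - g) s = ((n : ℝ) + 1) * f s - min ((n : ℝ) * f s) 1 := by
        simp [hg]
      rw [h3]
      nlinarith
  have hgD : g ∈ Df gg f := by
    refine ⟨hgN, 1 - g, Or.inr ⟨gg.G.sub_mem hone hgG, fun s => ?_,
      {s | (n : ℝ) * f s < 1}, ?_, ?_, fun s hs _ => ?_⟩, by abel⟩
    · simp [hg]
    · exact isOpen_lt (by fun_prop) continuous_const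
    · simp [hft0]
    · have h3 : (1 - g) s = 1 - min ((n : ℝ) * f s) 1 := by simp [hg]
      rw [h3]
      have h1 := min_le_left ((n : ℝ) * f s) 1
      have h2 : (n : ℝ) * f s < 1 := hs
      linarith
  have hgt : g t = 1 := by
    rw [hg]
    exact min_eq_right hn1.le
  refine IsGreatest.csSup_eq ⟨⟨g, hgD, hgt⟩, ?_⟩
  rintro r ⟨k, ⟨_, z, hz, hk⟩, rfl⟩
  have h1 := congrArg (fun h : C(X, ℝ) => h t) hk
  simp only [ContinuousMap.add_apply, ContinuousMap.one_apply] at h1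
  have := hM0 z hz t
  linarith
end

section
/- Let f ∈ M be nonzero with f ≤_M f0 and let E be a complemented interval in N_f with E ≠ {0}. Then the function t ↦ sup{g(t) : g ∈ E} is a bounded continuous real-valued function on U_f and belongs to L_f. -/
open Topology Set Pointwise

variable {X : Type*} [TopologicalSpace X] {t0 : X}

theorem aux_nonneg (gg : GoodGroup X t0) {g : C(X, ℝ)} (h : g ∈ Mset gg) (t : X) : 0 ≤ g t := by
  rcases h with h | h
  · simp [h]
  · exact h.2.1 t

theorem aux_Df_le (gg : GoodGroup X t0) {f g : C(X, ℝ)} (h : g ∈ Df gg f) (t : X) : g t ≤ 1 := by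
  obtain ⟨z, hz, he⟩ := h.2
  have h1 := aux_nonneg gg hz t
  have h2 := congrArg (fun u : C(X, ℝ) => u t) he
  simp at h2
  linarith

theorem aux_one_mem (gg : GoodGroup X t0) : (1 : C(X, ℝ)) ∈ gg.G := by
  obtain ⟨U, -, hU, -, r, hr, -, h1, -⟩ :=
    gg.urysohn univ univ isClosed_univ isOpen_univ (subset_refl _) 1 zero_le_one
  have : r = 1 := by
    ext t
    simpa using h1 t (hU (mem_univ t))
  rwa [this] at hr

theorem aux_exists (gg : GoodGroup X t0) (f : C(X, ℝ)) (hfM : f ∈ Mset gg) (hf : f ≠ 0)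
    (hff0 : leM gg f gg.f0) (t : X) (ht : t ∈ Uf f) : ∃ g ∈ Df gg f, g t = 1 := by
  have hf00 : f t0 = 0 := by
    obtain ⟨z, hz, he⟩ := hff0
    have h1 := aux_nonneg gg hz t0
    have h2 := congrArg (fun u : C(X, ℝ) => u t0) he
    have h3 := aux_nonneg gg hfM t0
    have h4 := gg.f0_zero
    simp at h2
    linarith
  rcases hfM with h | ⟨hG, hnn, V, hV, htV, hpos⟩
  · exact absurd h hf
  have hft : 0 < f t := lt_of_le_of_ne (hnn t) (Ne.symm ht)
  obtain ⟨n, hn⟩ := exists_nat_gt (1 / f t)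
  rw [div_lt_iff₀ hft] at hn
  have hn0 : (0 : ℝ) < n := by
    by_contra hc
    nlinarith
  have hgG : (n • f) ⊓ 1 ∈ gg.G := gg.inf_mem _ _ (gg.G.nsmul_mem hG n) (aux_one_mem gg)
  have hval : ∀ s, ((n • f) ⊓ 1 : C(X, ℝ)) s = min (n * f s) 1 := by
    intro s; simp [nsmul_eq_mul]
  refine ⟨(n • f) ⊓ 1, ⟨⟨Or.inr ⟨hgG, ?_, V, hV, htV, ?_⟩, n + 1, by omega,
    (n + 1) • f - (n • f) ⊓ 1, Or.inr ⟨gg.G.sub_mem (gg.G.nsmul_mem hG _) hgG, ?_, V, hV, htV, ?_⟩,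
      by abel⟩, 1 - (n • f) ⊓ 1, Or.inr ⟨gg.G.sub_mem (aux_one_mem gg) hgG, ?_,
        {s | n * f s < 1}, ?_, ?_, ?_⟩, by abel⟩, ?_⟩
  · intro s
    rw [hval]
    exact le_min (mul_nonneg hn0.le (hnn s)) zero_le_one
  · intro s hs hs0
    rw [hval]
    exact lt_min (mul_pos hn0 (hpos s hs hs0)) one_pos
  · intro s
    have h1 := min_le_left (n * f s) 1
    rw [ContinuousMap.sub_apply, hval, ContinuousMap.nsmul_apply, nsmul_eq_mul]
    push_cast
    linarith [hnn s]
  · intro s hs hs0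
    have h1 := min_le_left (n * f s) 1
    rw [ContinuousMap.sub_apply, hval, ContinuousMap.nsmul_apply, nsmul_eq_mul]
    push_cast
    linarith [hpos s hs hs0]
  · intro s
    rw [ContinuousMap.sub_apply, hval]
    have h1 := min_le_right (n * f s) 1
    simp only [ContinuousMap.one_apply]
    linarith
  · exact isOpen_lt (by fun_prop) continuous_const
  · simp [hf00]
  · intro s hs _
    rw [ContinuousMap.sub_apply, hval]
    have h1 := min_le_left (n * f s) 1
    have h2 : n * f s < 1 := hs
    simp only [ContinuousMap.one_apply]
    linarith
  · rw [hval]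
    exact min_eq_right hn.le

variable [CompactSpace X] [TopologicalSpace.MetrizableSpace X] [Infinite X]

/-- the pointwise supremum of a nonzero complemented interval is a
bounded continuous function on `U_f` belonging to `L_f`. -/
theorem statement_7 (ht0 : Filter.NeBot (𝓝[≠] t0)) (gg : GoodGroup X t0)
    (f : C(X, ℝ)) (hfM : f ∈ Mset gg) (hf : f ≠ 0) (hff0 : leM gg f gg.f0)
    (E : Set C(X, ℝ)) (hE : IsCompInterval gg f E) (hEne : E ≠ {0}) :
    ContinuousOn (fun t => sSup {r : ℝ | ∃ g ∈ E, g t = r}) (Uf f) ∧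
    (∃ C : ℝ, ∀ t ∈ Uf f, sSup {r : ℝ | ∃ g ∈ E, g t = r} ≤ C) ∧
    MemLf gg f (fun t => sSup {r : ℝ | ∃ g ∈ E, g t = r}) := by
  obtain ⟨hEI, F, hFI, k, hk, hsum⟩ := hE
  have hle : ∀ x ∈ E, ∀ y ∈ F, ∀ t, x t + y t ≤ k := by
    intro x hx y hy t
    have h : x + y ∈ nFold k (Df gg f) := hsum ▸ Set.add_mem_add hx hy
    obtain ⟨w, hw, he⟩ := h
    have h2 := congrArg (fun u : C(X, ℝ) => u t) he
    simp only [ContinuousMap.add_apply, ContinuousMap.sum_apply] at h2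
    rw [h2]
    calc ∑ i, w i t ≤ ∑ _i : Fin k, (1 : ℝ) :=
          Finset.sum_le_sum fun i _ => aux_Df_le gg (hw i) t
      _ = k := by simp
  have hatt : ∀ t ∈ Uf f, ∃ x ∈ E, ∃ y ∈ F, x t + y t = k := by
    intro t ht
    obtain ⟨g, hg, hgt⟩ := aux_exists gg f hfM hf hff0 t ht
    have h : (∑ _i : Fin k, g) ∈ E + F := hsum ▸ ⟨fun _ => g, fun _ => hg, rfl⟩
    obtain ⟨x, hx, y, hy, he⟩ := Set.mem_add.1 h
    refine ⟨x, hx, y, hy, ?_⟩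
    have h2 := congrArg (fun u : C(X, ℝ) => u t) he
    simp only [ContinuousMap.add_apply, ContinuousMap.sum_apply] at h2
    rw [h2]
    simp [hgt]
  have hFnn : ∀ y ∈ F, ∀ t, 0 ≤ y t := fun y hy t => aux_nonneg gg (hFI.2.1 hy).1 t
  have hEnn : ∀ y ∈ E, ∀ t, 0 ≤ y t := fun y hy t => aux_nonneg gg (hEI.2.1 hy).1 t
  obtain ⟨y0, hy0⟩ := hFI.1
  obtain ⟨x0, hx0⟩ := hEI.1
  have hub : ∀ y ∈ F, ∀ t, sSup {r : ℝ | ∃ g ∈ E, g t = r} ≤ k - y t := by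
    intro y hy t
    refine csSup_le ⟨_, x0, hx0, rfl⟩ ?_
    rintro _ ⟨g, hg, rfl⟩
    linarith [hle g hg y hy t]
  have hlb : ∀ x ∈ E, ∀ t, x t ≤ sSup {r : ℝ | ∃ g ∈ E, g t = r} := by
    intro x hx t
    refine le_csSup ⟨k, ?_⟩ ⟨x, hx, rfl⟩
    rintro _ ⟨g, hg, rfl⟩
    linarith [hle g hg y0 hy0 t, hFnn y0 hy0 t]
  have hc : ContinuousOn (fun t => sSup {r : ℝ | ∃ g ∈ E, g t = r}) (Uf f) := by
    intro t ht
    obtain ⟨x, hx, y, hy, hxy⟩ := hatt t ht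
    have e : sSup {r : ℝ | ∃ g ∈ E, g t = r} = x t :=
      le_antisymm (by linarith [hub y hy t]) (hlb x hx t)
    refine ContinuousAt.continuousWithinAt ?_
    have h1 : Filter.Tendsto x (𝓝 t) (𝓝 (x t)) := x.continuous.tendsto t
    have h2 : Filter.Tendsto (fun s => (k : ℝ) - y s) (𝓝 t) (𝓝 (x t)) := by
      have h3 : x t = k - y t := by linarith
      rw [h3]
      exact tendsto_const_nhds.sub (y.continuous.tendsto t)
    unfold ContinuousAt
    beta_reduce
    rw [e]
    exact tendsto_of_tendsto_of_tendsto_of_le_of_le h1 h2 (hlb x hx) (hub y hy)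
  have hb : ∃ C : ℝ, ∀ t ∈ Uf f, sSup {r : ℝ | ∃ g ∈ E, g t = r} ≤ C :=
    ⟨k, fun t _ => by linarith [hub y0 hy0 t, hFnn y0 hy0 t]⟩
  refine ⟨hc, hb, hc, hb, fun t _ => (hEnn x0 hx0 t).trans (hlb x0 hx0 t), Or.inr ?_⟩
  by_contra hcon
  apply hEne
  have hz : ∀ x ∈ E, x = 0 := by
    intro x hx
    by_contra hx0
    exact hcon ⟨x, hEI.2.1 hx, hx0, fun t _ => hlb x hx t⟩
  exact Set.eq_singleton_iff_nonempty_unique_mem.2 ⟨hEI.1, hz⟩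
end

section
/- Let f, f' ∈ M be nonzero with f' ≤_M f ≤_M f0, and let E be a complemented interval in N_f with E ≠ {0}. Then for every t ∈ U_{f'}, sup{g(t) : g ∈ E ∩ N_{f'}} = sup{g(t) : g ∈ E}; that is, the pointwise supremum of the restricted interval E ∩ N_{f'} coincides on U_{f'} with the restriction of the pointwise supremum of E. -/
open Topology Set Pointwise

variable {X : Type*} [TopologicalSpace X] {t0 : X}

variable [CompactSpace X] [TopologicalSpace.MetrizableSpace X] [Infinite X]

theorem aux_add {X : Type*} [TopologicalSpace X] {t0 : X} (gg : GoodGroup X t0) (a b : C(X, ℝ))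
    (ha : a ∈ Mset gg) (hb : b ∈ Mset gg) : a + b ∈ Mset gg := by
  rcases ha with rfl | ⟨ha, ha0, V, hV, hVt, hVp⟩
  · simpa using hb
  rcases hb with rfl | ⟨hb, hb0, W, hW, hWt, hWp⟩
  · rw [add_zero]
    exact Or.inr ⟨ha, ha0, V, hV, hVt, hVp⟩
  refine Or.inr ⟨gg.G.add_mem ha hb, fun s => add_nonneg (ha0 s) (hb0 s), V, hV, hVt, ?_⟩
  intro s hs hst
  exact add_pos_of_pos_of_nonneg (hVp s hs hst) (hb0 s)

theorem aux_nonneg_s8 {X : Type*} [TopologicalSpace X] {t0 : X} (gg : GoodGroup X t0) (a : C(X, ℝ))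
    (ha : a ∈ Mset gg) (s : X) : 0 ≤ a s := by
  rcases ha with rfl | ⟨ha, ha0, _⟩
  · simp
  · exact ha0 s

theorem aux_loc {X : Type*} [TopologicalSpace X] {t0 : X} (ht0 : Filter.NeBot (𝓝[≠] t0))
    (gg : GoodGroup X t0) (a : C(X, ℝ))
    (ha : a ∈ Mset gg) (hne : a ≠ 0) (h0 : a t0 = 0) :
    a ∈ gg.G ∧ (∀ s, 0 ≤ a s) ∧ ∃ V : Set X, IsOpen V ∧ t0 ∈ V ∧ ∃ mu : ℝ, 0 < mu ∧
      ∀ s ∈ V, a s = mu * gg.f0 s := by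
  rcases ha with h | ⟨ha, ha0, V, hV, hVt, hVp⟩
  · exact absurd h hne
  refine ⟨ha, ha0, ?_⟩
  obtain ⟨W, hW, hWt, lam, mu, h⟩ := gg.loc_affine a ha
  have hl : (lam : ℝ) = 0 := by
    have := h t0 hWt
    rw [h0, gg.f0_zero] at this
    linarith
  rw [hl] at h
  refine ⟨W, hW, hWt, mu, ?_, fun s hs => by rw [h s hs]; ring⟩
  have hmem : V ∩ W ∈ 𝓝 t0 := (hV.inter hW).mem_nhds ⟨hVt, hWt⟩
  have h2 : (V ∩ W) ∩ {t0}ᶜ ∈ 𝓝[≠] t0 :=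
    Filter.inter_mem (mem_nhdsWithin_of_mem_nhds hmem) self_mem_nhdsWithin
  obtain ⟨s, ⟨hsV, hsW⟩, hst⟩ := ht0.nonempty_of_mem h2
  have hst : s ≠ t0 := hst
  have h3 := hVp s hsV hst
  rw [h s hsW, zero_add] at h3
  exact pos_of_mul_pos_left h3 (gg.f0_nonneg s)

/-- the pointwise supremum of the restricted interval `E ∩ N_{f'}`
agrees on `U_{f'}` with that of `E`. -/
theorem statement_8 (ht0 : Filter.NeBot (𝓝[≠] t0)) (gg : GoodGroup X t0)
    (f f' : C(X, ℝ)) (hfM : f ∈ Mset gg) (hf'M : f' ∈ Mset gg)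
    (hf : f ≠ 0) (hf' : f' ≠ 0) (hf'f : leM gg f' f) (hff0 : leM gg f gg.f0)
    (E : Set C(X, ℝ)) (hE : IsCompInterval gg f E) (hEne : E ≠ {0}) :
    ∀ t ∈ Uf f', sSup {r : ℝ | ∃ g ∈ E ∩ Nf gg f', g t = r}
      = sSup {r : ℝ | ∃ g ∈ E, g t = r} := by
  intro t ht
  have hnn := aux_nonneg_s8 gg
  obtain ⟨zf, hzf, hzf'⟩ := hff0
  have hft0 : f t0 = 0 := by
    have h1 := congrArg (fun q : C(X, ℝ) => q t0) hzf'
    simp only [ContinuousMap.add_apply, gg.f0_zero] at h1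
    have := hnn f hfM t0
    have := hnn zf hzf t0
    linarith
  obtain ⟨zf2, hzf2, hzf2'⟩ := hf'f
  have hf't0 : f' t0 = 0 := by
    have h1 := congrArg (fun q : C(X, ℝ) => q t0) hzf2'
    simp only [ContinuousMap.add_apply, hft0] at h1
    have := hnn f' hf'M t0
    have := hnn zf2 hzf2 t0
    linarith
  obtain ⟨hf'G, hf'0, V1, hV1, hV1t, mu, hmu, hf'mu⟩ := aux_loc ht0 gg f' hf'M hf' hf't0
  have htt0 : t ≠ t0 := by
    rintro rfl
    exact ht hf't0
  have hf't : 0 < f' t := lt_of_le_of_ne (hf'0 t) (Ne.symm ht)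
  obtain ⟨⟨_, hEN, hEher, _⟩, _⟩ := hE
  congr 1
  ext x
  constructor
  · rintro ⟨g, hg, rfl⟩
    exact ⟨g, hg.1, rfl⟩
  rintro ⟨g, hg, rfl⟩
  by_cases hg0 : g = 0
  · refine ⟨g, ⟨hg, ?_⟩, rfl⟩
    subst hg0
    exact ⟨Or.inl rfl, 1, le_refl _, f', hf'M, by simp⟩
  obtain ⟨hgM, m, hm, z, hz, hmf⟩ := hEN hg
  have hgt0 : g t0 = 0 := by
    have h1 := congrArg (fun q : C(X, ℝ) => q t0) hmf
    simp only [ContinuousMap.add_apply, ContinuousMap.nsmul_apply, hft0, smul_zero] at h1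
    have := hnn g hgM t0
    have := hnn z hz t0
    linarith
  obtain ⟨hgG, hgn, V2, hV2, hV2t, nu, hnu, hgnu⟩ := aux_loc ht0 gg g hgM hg0 hgt0
  obtain ⟨n1, hn1⟩ := exists_nat_gt (nu / mu)
  obtain ⟨n2, hn2⟩ := exists_nat_gt (g t / f' t)
  obtain ⟨R, hR⟩ := exists_nat_gt (g t)
  rw [div_lt_iff₀ hmu] at hn1
  rw [div_lt_iff₀ hf't] at hn2
  obtain ⟨n, hn, hna, hnb⟩ : ∃ n : ℕ, 1 ≤ n ∧ nu < n * mu ∧ g t < n * f' t := by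
    refine ⟨n1 + n2 + 1, by omega, ?_, ?_⟩
    · push_cast
      nlinarith [mul_nonneg (Nat.cast_nonneg (α := ℝ) n2) hmu.le]
    · push_cast
      nlinarith [mul_nonneg (Nat.cast_nonneg (α := ℝ) n1) hf't.le]
  obtain ⟨u, v, hu, hv, htu, htv, huv⟩ := t2_separation htt0
  obtain ⟨U, hU, htU, hUu, r, hrG, hr, hrU, hru⟩ := gg.urysohn {t} u isClosed_singleton hu
    (by simpa using htu) (R : ℚ) (by positivity)
  have hrt : r t = R := by simpa using hrU t (htU rfl)
  have hrv : ∀ s ∈ v, r s = 0 := fun s hs => hru s (fun h => huv.le_bot ⟨h, hs⟩)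
  let g' : C(X, ℝ) := (g ⊓ (((1 / 2 : ℚ) : ℝ) • g + r)) ⊓ (n • f')
  have hg's : ∀ s, g' s = min (min (g s) (g s / 2 + r s)) (n * f' s) := by
    intro s
    simp [g']
    ring_nf
  have hg'G : g' ∈ gg.G := gg.inf_mem _ _ (gg.inf_mem _ _ hgG
    (gg.G.add_mem (gg.rat_smul_mem _ _ hgG) hrG)) (gg.G.nsmul_mem hf'G n)
  have hg'0 : ∀ s, 0 ≤ g' s := by
    intro s
    rw [hg's]
    have := hgn s
    have := (hr s).1
    have := hf'0 s
    refine le_min (le_min ?_ ?_) ?_ <;> positivity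
  have hWo : IsOpen (V1 ∩ V2 ∩ v) := (hV1.inter hV2).inter hv
  have hWt : t0 ∈ V1 ∩ V2 ∩ v := ⟨⟨hV1t, hV2t⟩, htv⟩
  have hnear : ∀ s ∈ V1 ∩ V2 ∩ v, s ≠ t0 → 0 < g s ∧ g' s = g s / 2 ∧ g s < n * f' s := by
    rintro s ⟨⟨h1, h2⟩, h3⟩ hs
    have hp := gg.f0_pos s hs
    have hgp : 0 < g s := by rw [hgnu s h2]; positivity
    have hlt : g s < n * f' s := by
      rw [hgnu s h2, hf'mu s h1, ← mul_assoc]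
      exact mul_lt_mul_of_pos_right hna hp
    refine ⟨hgp, ?_, hlt⟩
    rw [hg's, hrv s h3, add_zero, min_eq_right (a := g s) (by linarith), min_eq_left (by linarith)]
  have hg'M : g' ∈ Mset gg := by
    refine Or.inr ⟨hg'G, hg'0, _, hWo, hWt, fun s hs hst => ?_⟩
    obtain ⟨h1, h2, h3⟩ := hnear s hs hst
    linarith
  have hle : g - g' ∈ Mset gg := by
    refine Or.inr ⟨gg.G.sub_mem hgG hg'G, fun s => ?_, _, hWo, hWt, fun s hs hst => ?_⟩
    · have : g' s ≤ g s := by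
        rw [hg's]; exact (min_le_left _ _).trans (min_le_left _ _)
      simpa using this
    · obtain ⟨h1, h2, h3⟩ := hnear s hs hst
      simp only [ContinuousMap.sub_apply]
      linarith
  have hle2 : n • f' - g' ∈ Mset gg := by
    refine Or.inr ⟨gg.G.sub_mem (gg.G.nsmul_mem hf'G n) hg'G, fun s => ?_, _, hWo, hWt,
      fun s hs hst => ?_⟩
    · have : g' s ≤ n * f' s := by
        rw [hg's]; exact min_le_right _ _
      simpa using this
    · obtain ⟨h1, h2, h3⟩ := hnear s hs hst
      rw [ContinuousMap.sub_apply, ContinuousMap.nsmul_apply, nsmul_eq_mul]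
      linarith
  refine ⟨g', ⟨?_, hg'M, n, hn, _, hle2, by abel⟩, ?_⟩
  · refine hEher g' ⟨hg'M, m, hm, _, aux_add gg _ _ hle hz, ?_⟩ g hg ⟨_, hle, by abel⟩
    rw [hmf]; abel
  · rw [hg's, hrt]
    have := hgn t
    rw [min_eq_left (a := g t) (by linarith), min_eq_left (by linarith)]
end

section
/- Let f ∈ M be nonzero with f ≤_M f0, and let g, h ∈ L_f be nonzero functions having property (C) such that g ≤ h on U_f and such that h − g is a nonzero element of L_f (i.e., there is a nonzero z ∈ N_f with z ≤ h − g on U_f). Then h − g has property (C). -/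
open Topology Set Pointwise

variable {X : Type*} [TopologicalSpace X] {t0 : X}

variable [CompactSpace X] [TopologicalSpace.MetrizableSpace X] [Infinite X]

/-- property (C) passes to differences. -/
theorem statement_9 (ht0 : Filter.NeBot (𝓝[≠] t0)) (gg : GoodGroup X t0)
    (f : C(X, ℝ)) (hfM : f ∈ Mset gg) (hf : f ≠ 0) (hff0 : leM gg f gg.f0)
    (g h : X → ℝ) (hg : MemLfNZ gg f g) (hh : MemLfNZ gg f h)
    (hgC : PropC gg f g) (hhC : PropC gg f h)
    (hgh : ∀ t ∈ Uf f, g t ≤ h t)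
    (hdiff : ∃ z ∈ Nf gg f, z ≠ (0 : C(X, ℝ)) ∧ ∀ t ∈ Uf f, z t ≤ h t - g t) :
    PropC gg f (fun t => h t - g t) := by
  intro t ht htt0
  obtain ⟨a, haN, hale, ⟨Wa, hWao, hta, haW⟩, -⟩ := hgC t ht htt0
  obtain ⟨b, hbN, hble, ⟨Wb, hWbo, htb, hbW⟩, -⟩ := hhC t ht htt0
  obtain ⟨w, hwN, hw0, hwle⟩ := hdiff
  have hMG : ∀ x ∈ Mset gg, x ∈ gg.G ∧ ∀ s, 0 ≤ x s := by
    rintro x (rfl | ⟨h1, h2, -⟩)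
    · exact ⟨gg.G.zero_mem, fun s => le_rfl⟩
    · exact ⟨h1, h2⟩
  have hN : ∀ x ∈ Nf gg f, ∃ n : ℕ, ∀ s, x s ≤ n * f s := by
    rintro x ⟨-, n, -, y, hy, hxy⟩
    refine ⟨n, fun s => ?_⟩
    have h1 := (hMG y hy).2 s
    have h2 := congrArg (fun k : C(X, ℝ) => k s) hxy
    simp at h2
    linarith
  obtain ⟨haG, ha0⟩ := hMG a haN.1
  obtain ⟨hbG, hb0⟩ := hMG b hbN.1
  obtain ⟨hwG, hwnn⟩ := hMG w hwN.1
  obtain ⟨hfG, hfnn⟩ := hMG f hfM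
  obtain ⟨nb, hnb⟩ := hN b hbN
  obtain ⟨nw, hnw⟩ := hN w hwN
  obtain ⟨Vf, hVfo, hVf0, hVf⟩ : ∃ V : Set X, IsOpen V ∧ t0 ∈ V ∧ ∀ t ∈ V, t ≠ t0 → 0 < f t := by
    rcases hfM with h1 | ⟨-, -, h1⟩
    · exact absurd h1 hf
    · exact h1
  obtain ⟨Vw, hVwo, hVw0, hVw⟩ : ∃ V : Set X, IsOpen V ∧ t0 ∈ V ∧ ∀ t ∈ V, t ≠ t0 → 0 < w t := by
    rcases hwN.1 with h1 | ⟨-, -, h1⟩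
    · exact absurd h1 hw0
    · exact h1
  obtain ⟨ρ, hρ⟩ := exists_nat_gt (b t - a t)
  have hfo : IsOpen (Uf f) := isOpen_ne_fun f.continuous continuous_const
  have hO1 : IsOpen {s | gg.f0 t / 2 < gg.f0 s} := isOpen_lt continuous_const gg.f0.continuous
  have hO2 : IsOpen {s | gg.f0 s < gg.f0 t / 2} := isOpen_lt gg.f0.continuous continuous_const
  have hO3 : IsOpen {s | b s - a s < ρ} :=
    isOpen_lt (b.continuous.sub a.continuous) continuous_const
  have hf0t := gg.f0_pos t htt0
  obtain ⟨U, hUo, htU, hUV, r, hrG, hr, hrU, hrV⟩ := gg.urysohn {t}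
    (((Wa ∩ Wb) ∩ Uf f) ∩ {s | gg.f0 t / 2 < gg.f0 s}) isClosed_singleton
    (((hWao.inter hWbo).inter hfo).inter hO1)
    (by
      rintro s rfl
      exact ⟨⟨⟨hta, htb⟩, ht⟩, half_lt_self hf0t⟩) (ρ : ℚ) (by positivity)
  have hba : ∀ s ∈ ((Wa ∩ Wb) ∩ Uf f) ∩ {s | gg.f0 t / 2 < gg.f0 s}, b s - a s = h s - g s := by
    rintro s ⟨⟨⟨h1, h2⟩, h3⟩, -⟩
    rw [haW s ⟨h1, h3⟩, hbW s ⟨h2, h3⟩]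
  obtain ⟨z, hzG, hz⟩ : ∃ z ∈ gg.G, ∀ s, z s = max (min (r s) (max (b s - a s) 0)) (w s / 2) := by
    refine ⟨(r ⊓ ((b - a) ⊔ 0)) ⊔ (((1 / 2 : ℚ) : ℝ) • w), gg.sup_mem _ _ (gg.inf_mem _ _ hrG
      (gg.sup_mem _ _ (gg.G.sub_mem hbG haG) gg.G.zero_mem)) (gg.rat_smul_mem _ _ hwG), ?_⟩
    intro s
    simp
    congr 1
    ring
  have hznn : ∀ s, 0 ≤ z s := fun s => by
    rw [hz]; exact le_max_of_le_right (by linarith [hwnn s])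
  have hzn : ∀ s, z s ≤ (nb + nw) * f s := fun s => by
    have h1 : 0 ≤ nb * f s := mul_nonneg (by positivity) (hfnn s)
    have h2 : 0 ≤ nw * f s := mul_nonneg (by positivity) (hfnn s)
    rw [hz]
    refine max_le (min_le_of_right_le (max_le ?_ ?_)) ?_ <;>
      linarith [hnb s, hnw s, ha0 s, hwnn s]
  refine ⟨z, ⟨Or.inr ⟨hzG, hznn, Vw, hVwo, hVw0, fun s hs hs0 => ?_⟩, nb + nw + 1, by omega,
    (nb + nw + 1) • f - z, Or.inr ⟨gg.G.sub_mem (gg.G.nsmul_mem hfG _) hzG, fun s => ?_,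
      Vf, hVfo, hVf0, fun s hs hs0 => ?_⟩, by abel⟩, fun s hs => ?_,
      ⟨U ∩ {s | b s - a s < ρ}, hUo.inter hO3, ⟨htU rfl, hρ⟩, ?_⟩,
      ⟨Vw ∩ {s | gg.f0 s < gg.f0 t / 2}, hVwo.inter hO2,
        ⟨hVw0, by simp only [mem_ofPred_eq, gg.f0_zero]; linarith⟩, ?_⟩⟩
  · rw [hz]; exact lt_max_of_lt_right (by linarith [hVw s hs hs0])
  · simp
    nlinarith [hzn s, hfnn s]
  · simp
    nlinarith [hzn s, hVf s hs hs0]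
  · have h1 := hgh s hs
    have h2 := hwle s hs
    have h3 := hwnn s
    simp only [hz]
    refine max_le ?_ (by linarith)
    by_cases hsV : s ∈ ((Wa ∩ Wb) ∩ Uf f) ∩ {s | gg.f0 t / 2 < gg.f0 s}
    · exact min_le_of_right_le (max_le (hba s hsV).le (by linarith))
    · exact min_le_of_left_le (by rw [hrV s hsV]; linarith)
  · rintro s ⟨⟨hsU, hsρ⟩, hs⟩
    have h1 := hgh s hs
    have h2 := hwle s hs
    have h3 := hwnn s
    have h4 := hba s (hUV hsU)
    have h5 : r s = ρ := by simpa using hrU s hsU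
    simp only [mem_ofPred_eq] at hsρ
    simp only [hz]
    rw [max_eq_left (show (0 : ℝ) ≤ b s - a s by linarith), h5, min_eq_right hsρ.le,
      max_eq_left (by linarith), h4]
  · rintro s ⟨⟨⟨hsV, hs2⟩, hs0⟩, hs⟩
    have h2 := hwle s hs
    have h3 := hVw s hsV hs0
    have h4 : r s = 0 := hrV s (fun h => by
      have h5 : gg.f0 t / 2 < gg.f0 s := h.2
      have h6 : gg.f0 s < gg.f0 t / 2 := hs2
      linarith)
    simp only [hz]
    refine max_lt (min_lt_of_left_lt ?_) ?_ <;> linarith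
end

section
/- Let f ∈ M be nonzero with f ≤_M f0, let h ∈ L_f be nonzero with property (C), and let K be a compact subset of X with K ⊆ U_f. Then there exists z ∈ I_f(h) such that z = h on K. Moreover, if v ∈ I_f(h) is given, then z can be chosen such that, in addition, v ≤_M z. -/
open Topology Set Pointwise

variable {X : Type*} [TopologicalSpace X] {t0 : X}

theorem ev_of_open {p : X → Prop}
    (hp : ∃ V : Set X, IsOpen V ∧ t0 ∈ V ∧ ∀ t ∈ V, t ≠ t0 → p t) :
    ∀ᶠ t in 𝓝[≠] t0, p t := by
  obtain ⟨V, hV, h0, hp⟩ := hp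
  rw [eventually_nhdsWithin_iff]
  filter_upwards [hV.mem_nhds h0] with t ht hne using hp t ht hne

theorem open_of_ev {p : X → Prop} (hp : ∀ᶠ t in 𝓝[≠] t0, p t) :
    ∃ V : Set X, IsOpen V ∧ t0 ∈ V ∧ ∀ t ∈ V, t ≠ t0 → p t := by
  rw [eventually_nhdsWithin_iff, eventually_nhds_iff] at hp
  obtain ⟨V, h1, h2, h3⟩ := hp
  exact ⟨V, h2, h3, h1⟩

theorem mem_M {gg : GoodGroup X t0} {g : C(X, ℝ)} (hg : g ∈ gg.G) (h0 : ∀ t, 0 ≤ g t)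
    (hp : ∀ᶠ t in 𝓝[≠] t0, 0 < g t) : g ∈ Mset gg :=
  Or.inr ⟨hg, h0, open_of_ev hp⟩

theorem M_G {gg : GoodGroup X t0} {g : C(X, ℝ)} (hg : g ∈ Mset gg) : g ∈ gg.G := by
  rcases hg with rfl | hg
  · exact gg.G.zero_mem
  · exact hg.1

theorem M_nn {gg : GoodGroup X t0} {g : C(X, ℝ)} (hg : g ∈ Mset gg) (t : X) : 0 ≤ g t := by
  rcases hg with rfl | hg
  · simp
  · exact hg.2.1 t

theorem M_pos {gg : GoodGroup X t0} {g : C(X, ℝ)} (hg : g ∈ Mset gg) (h0 : g ≠ 0) :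
    ∀ᶠ t in 𝓝[≠] t0, 0 < g t := by
  rcases hg with rfl | hg
  · exact absurd rfl h0
  · exact ev_of_open hg.2.2

/-- Auxiliary class of minorants of `h`. -/
structure Good (gg : GoodGroup X t0) (f : C(X, ℝ)) (h : X → ℝ) (g : C(X, ℝ)) : Prop where
  mem : g ∈ gg.G
  nn : ∀ t, 0 ≤ g t
  bd : ∃ n : ℕ, ∀ t, g t ≤ n * f t
  le : ∀ t ∈ Uf f, g t ≤ h t
  lt : ∀ᶠ t in 𝓝[≠] t0, t ∈ Uf f → g t < h t

theorem Nf_bd {gg : GoodGroup X t0} {f g : C(X, ℝ)} (hg : g ∈ Nf gg f) :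
    ∃ n : ℕ, ∀ t, g t ≤ n * f t := by
  obtain ⟨-, n, -, z, hz, e⟩ := hg
  refine ⟨n, fun t => ?_⟩
  have := DFunLike.congr_fun e t
  have h2 := M_nn hz t
  simp at this
  linarith

theorem Good.of_Nf {gg : GoodGroup X t0} {f g : C(X, ℝ)} {h : X → ℝ} (hg : g ∈ Nf gg f)
    (hle : ∀ t ∈ Uf f, g t ≤ h t)
    (hlt : ∃ V : Set X, IsOpen V ∧ t0 ∈ V ∧ ∀ s ∈ (V \ {t0}) ∩ Uf f, g s < h s) :
    Good gg f h g := by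
  refine ⟨M_G hg.1, M_nn hg.1, Nf_bd hg, hle, ?_⟩
  obtain ⟨V, h1, h2, h3⟩ := hlt
  exact ev_of_open ⟨V, h1, h2, fun t ht hne hU => h3 t ⟨⟨ht, hne⟩, hU⟩⟩

theorem Good.sup {gg : GoodGroup X t0} {f a b : C(X, ℝ)} {h : X → ℝ} (hf : ∀ t, 0 ≤ f t)
    (ha : Good gg f h a) (hb : Good gg f h b) : Good gg f h (a ⊔ b) := by
  refine ⟨gg.sup_mem _ _ ha.mem hb.mem, fun t => ?_, ?_, fun t ht => ?_, ?_⟩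
  · exact le_sup_of_le_left (ha.nn t)
  · obtain ⟨n, hn⟩ := ha.bd
    obtain ⟨m, hm⟩ := hb.bd
    refine ⟨n + m, fun t => ?_⟩
    have h1 : 0 ≤ (n : ℝ) * f t := mul_nonneg n.cast_nonneg (hf t)
    have h2 : 0 ≤ (m : ℝ) * f t := mul_nonneg m.cast_nonneg (hf t)
    have h3 := hn t
    have h4 := hm t
    push_cast
    exact sup_le (by linarith) (by linarith)
  · exact sup_le (ha.le t ht) (hb.le t ht)
  · filter_upwards [ha.lt, hb.lt] with t h1 h2 hU
    exact sup_lt_iff.2 ⟨h1 hU, h2 hU⟩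

theorem mem_Nf {gg : GoodGroup X t0} {f g : C(X, ℝ)} (hfM : f ∈ Mset gg) (hf : f ≠ 0)
    (hg : g ∈ Mset gg) (hb : ∃ n : ℕ, ∀ t, g t ≤ n * f t) : g ∈ Nf gg f := by
  obtain ⟨n, hn⟩ := hb
  refine ⟨hg, n + 1, by omega, (n + 1) • f - g, ?_, by abel⟩
  refine mem_M (gg.G.sub_mem (gg.G.nsmul_mem (M_G hfM) _) (M_G hg)) (fun t => ?_) ?_
  · have h1 := hn t
    have h2 := M_nn hfM t
    simp
    linarith
  · filter_upwards [M_pos hfM hf] with t ht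
    have h1 := hn t
    simp
    linarith

theorem key [T1Space X] (ht0 : Filter.NeBot (𝓝[≠] t0)) (gg : GoodGroup X t0)
    (f : C(X, ℝ)) (hfM : f ∈ Mset gg) (hf : f ≠ 0) (hf0 : f t0 = 0)
    (h : X → ℝ) (hhC : PropC gg f h)
    (K : Set X) (hK : IsCompact K) (hKc : IsClosed K) (hKU : K ⊆ Uf f)
    (v v' : C(X, ℝ)) (hvG : v ∈ gg.G) (hv0 : ∀ t, 0 ≤ v t) (hv' : Good gg f h v')
    (hle : ∀ t, v t ≤ v' t) (hlt : ∀ᶠ t in 𝓝[≠] t0, v t < v' t) :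
    ∃ z ∈ Iset gg f h, (∀ t ∈ K, z t = h t) ∧ leM gg v z := by
  have htU : t0 ∉ Uf f := fun hc => hc hf0
  have main : ∃ w, Good gg f h w ∧ (∀ t, v' t ≤ w t) ∧ ∀ t ∈ K, t ∈ Uf f → w t = h t := by
    refine hK.induction_on
      (p := fun S => ∃ w, Good gg f h w ∧ (∀ t, v' t ≤ w t) ∧ ∀ t ∈ S, t ∈ Uf f → w t = h t)
      ⟨v', hv', fun t => le_rfl, by simp⟩ ?_ ?_ ?_
    · rintro S T hST ⟨w, h1, h2, h3⟩
      exact ⟨w, h1, h2, fun t ht => h3 t (hST ht)⟩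
    · rintro S T ⟨w, h1, h2, h3⟩ ⟨u, k1, k2, k3⟩
      refine ⟨w ⊔ u, h1.sup (M_nn hfM) k1, fun t => le_sup_of_le_left (h2 t), ?_⟩
      rintro t (ht | ht) hU
      · have := h3 t ht hU
        simpa [this] using k1.le t hU
      · have := k3 t ht hU
        simpa [this] using h1.le t hU
    · intro t ht
      obtain ⟨z, hz, hzle, ⟨W, hW, htW, hWe⟩, hV⟩ :=
        hhC t (hKU ht) (fun e => htU (e ▸ hKU ht))
      refine ⟨W, mem_nhdsWithin_of_mem_nhds (hW.mem_nhds htW), z ⊔ v',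
        (Good.of_Nf hz hzle hV).sup (M_nn hfM) hv', fun s => le_sup_right, ?_⟩
      intro s hs hU
      have := hWe s ⟨hs, hU⟩
      simpa [this] using hv'.le s hU
  obtain ⟨w, hw, hvw, hwK⟩ := main
  obtain ⟨U, hU, h0U, -, r, hrG, hr, hrU, hrK⟩ := gg.urysohn {t0} Kᶜ isClosed_singleton
    hKc.isOpen_compl (by
      rw [singleton_subset_iff]
      exact fun hc => htU (hKU hc)) 1 zero_le_one
  have hdG : w - v ∈ gg.G := gg.G.sub_mem hw.mem hvG
  set s : C(X, ℝ) := (((1 / 2 : ℚ) : ℝ) • (w - v)) ⊓ r with hs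
  have hst : ∀ t, s t = min ((w t - v t) / 2) (r t) := by
    intro t
    simp [hs]
    ring_nf
  have hsG : s ∈ gg.G := gg.inf_mem _ _ (gg.rat_smul_mem _ _ hdG) hrG
  have hvw2 : ∀ t, v t ≤ w t := fun t => (hle t).trans (hvw t)
  have hs0 : ∀ t, 0 ≤ s t := fun t => by
    rw [hst]
    exact le_min (by linarith [hvw2 t]) (hr t).1
  have hs2 : ∀ t, s t ≤ (w t - v t) / 2 := fun t => by
    rw [hst]
    exact min_le_left _ _
  have hdp : ∀ᶠ t in 𝓝[≠] t0, v t < w t := by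
    filter_upwards [hlt] with t ht using ht.trans_le (hvw t)
  have hsp : ∀ᶠ t in 𝓝[≠] t0, 0 < s t := by
    filter_upwards [hdp, mem_nhdsWithin_of_mem_nhds (hU.mem_nhds (h0U rfl))] with t ht htU
    rw [hst, hrU t htU]
    exact lt_min (by linarith) (by norm_num)
  have hsM : s ∈ Mset gg := mem_M hsG hs0 hsp
  obtain ⟨n, hn⟩ := hw.bd
  have hwM : w ∈ Mset gg := mem_M hw.mem hw.nn (by
    filter_upwards [hdp] with t ht using (hv0 t).trans_lt ht)
  have hzM : w - s ∈ Mset gg := by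
    refine mem_M (gg.G.sub_mem hw.mem hsG) (fun t => ?_) ?_
    · have h1 := hs2 t
      have h2 := hv0 t
      have h3 := hvw2 t
      simp
      linarith
    · filter_upwards [hdp] with t ht
      have h1 := hs2 t
      have h2 := hv0 t
      simp
      linarith
  refine ⟨w - s, Or.inr ⟨?_, w, ?_, ⟨⟨s, hsM, by abel⟩, ?_⟩, hw.le, ?_⟩, ?_, w - s - v, ?_, by abel⟩
  · refine mem_Nf hfM hf hzM ⟨n, fun t => ?_⟩
    have h1 := hn t
    have h2 := hs0 t
    simp
    linarith
  · exact mem_Nf hfM hf hwM hw.bd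
  · intro e
    obtain ⟨t, ht⟩ := hsp.exists
    have := DFunLike.congr_fun e t
    simp at this
    linarith
  · obtain ⟨V, h1, h2, h3⟩ := open_of_ev hw.lt
    exact ⟨V, h1, h2, fun t ht => h3 t ht.1.1 ht.1.2 ht.2⟩
  · intro t ht
    have h1 : s t = 0 := by
      refine le_antisymm ?_ (hs0 t)
      rw [hst, hrK t (fun hc => hc ht)]
      exact min_le_right _ _
    simp [h1, hwK t ht (hKU ht)]
  · refine mem_M (gg.G.sub_mem (gg.G.sub_mem hw.mem hsG) hvG) (fun t => ?_) ?_
    · have h1 := hs2 t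
      have h3 := hvw2 t
      simp
      linarith
    · filter_upwards [hdp] with t ht
      have h1 := hs2 t
      simp
      linarith

variable [CompactSpace X] [TopologicalSpace.MetrizableSpace X] [Infinite X]

/-- elements of `I_f(h)` agreeing with `h` on a given compact
subset of `U_f`, dominating a prescribed element of `I_f(h)`. -/
theorem statement_10 (ht0 : Filter.NeBot (𝓝[≠] t0)) (gg : GoodGroup X t0)
    (f : C(X, ℝ)) (hfM : f ∈ Mset gg) (hf : f ≠ 0) (hff0 : leM gg f gg.f0)
    (h : X → ℝ) (hh : MemLfNZ gg f h) (hhC : PropC gg f h)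
    (K : Set X) (hK : IsCompact K) (hKU : K ⊆ Uf f) :
    (∃ z ∈ Iset gg f h, ∀ t ∈ K, z t = h t) ∧
    ∀ v ∈ Iset gg f h, ∃ z ∈ Iset gg f h,
      (∀ t ∈ K, z t = h t) ∧ leM gg v z := by
  have hf0 : f t0 = 0 := by
    obtain ⟨z, hz, e⟩ := hff0
    have h1 := DFunLike.congr_fun e t0
    have h2 := M_nn hz t0
    have h3 := M_nn hfM t0
    have h4 := gg.f0_zero
    simp at h1
    linarith
  letI := TopologicalSpace.metrizableSpaceMetric X
  have second : ∀ v ∈ Iset gg f h, ∃ z ∈ Iset gg f h,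
      (∀ t ∈ K, z t = h t) ∧ leM gg v z := by
    rintro v (rfl | ⟨hv, v', hv', ⟨⟨d, hd, e⟩, hne⟩, hle, hlt⟩)
    · obtain ⟨-, -, -, y, hy, hy0, hyh⟩ := hh
      have hyp := M_pos hy.1 hy0
      have hyn := M_nn hy.1
      have e : ∀ t, (((1 / 2 : ℚ) : ℝ) • y) t = y t / 2 := by
        intro t
        simp
        ring
      refine key ht0 gg f hfM hf hf0 h hhC K hK hK.isClosed hKU 0 (((1 / 2 : ℚ) : ℝ) • y)
        gg.G.zero_mem (fun t => le_rfl)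
        ⟨gg.rat_smul_mem _ _ (M_G hy.1), fun t => ?_, ?_, fun t ht => ?_, ?_⟩ (fun t => ?_) ?_
      · rw [e]
        linarith [hyn t]
      · obtain ⟨n, hn⟩ := Nf_bd hy
        refine ⟨n, fun t => ?_⟩
        rw [e]
        linarith [hyn t, hn t]
      · rw [e]
        linarith [hyn t, hyh t ht]
      · filter_upwards [hyp] with t ht hU
        rw [e]
        linarith [hyh t hU]
      · rw [e, ContinuousMap.zero_apply]
        linarith [hyn t]
      · filter_upwards [hyp] with t ht
        rw [e, ContinuousMap.zero_apply]
        linarith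
    · have hd0 : d ≠ 0 := by
        rintro rfl
        exact hne (by simp [e])
      refine key ht0 gg f hfM hf hf0 h hhC K hK hK.isClosed hKU v v' (M_G hv.1) (M_nn hv.1)
        (Good.of_Nf hv' hle hlt) (fun t => ?_) ?_
      · have h1 := M_nn hd t
        rw [e, ContinuousMap.add_apply]
        linarith
      · filter_upwards [M_pos hd hd0] with t ht
        rw [e, ContinuousMap.add_apply]
        linarith
  refine ⟨?_, second⟩
  obtain ⟨z, h1, h2, -⟩ := second 0 (Or.inl rfl)
  exact ⟨z, h1, h2⟩
end
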